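/- arXiv:1404.1042 — 5 statements merged into one kernel-verified Lean document; each statement's English description precedes it below -/
import Mathlib

section
/- Reversal antisymmetry of alternal multitangents: let r ≥ 1 and let (s_1,…,s_r) be integers all ≥ 2. Then for every z ∈ ℂ ∖ ℤ, Tan^{s_r,…,s_1}(z) = (−1)^{r−1} · Tan^{s_1,…,s_r}(z). -/
/-- Multitangent function: `Te^{s₁,…,s_r}(z) = ∑_{n₁ > n₂ > ⋯ > n_r, nᵢ ∈ ℤ} ∏ (nᵢ + z)^{-sᵢ}`;
`Te^{∅}(z) = 1`. -/
noncomputable def Te (s : List ℕ) (z : ℂ) : ℂ :=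
  ∑' n : {n : Fin s.length → ℤ // StrictAnti n},
    ∏ i : Fin s.length, ((n.1 i : ℂ) + z) ^ (-(s.get i : ℤ))

/-- The mould logarithm of `Te`:
`Ten^{t₁,…,t_m}(z) = ∑_{j=1}^m ((−1)^{j−1}/j) ∑ ∏_{i=1}^j Te^{tⁱ}(z)`, the inner sum running
over all decompositions of `(t₁,…,t_m)` into `j` consecutive nonempty blocks `t¹,…,tʲ`. -/
noncomputable def Ten (t : List ℕ) (z : ℂ) : ℂ :=
  ∑ c : Composition t.length,
    ((-1 : ℂ)) ^ (c.length - 1) / (c.length : ℂ) *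
      ((t.splitWrtComposition c).map (fun b => Te b z)).prod

/-- The alternal multitangent, `Tan = logmu(Te) ∘ (E−1)`:
`Tan^{s₁,…,s_r}(z) = ∑ (∏_{j=1}^k 1/ℓⱼ!) · Ten^{b₁,…,b_k}(z)`, the sum running over all
decompositions of `(s₁,…,s_r)` into `k ≥ 1` consecutive nonempty blocks, where `ℓⱼ` is the
length and `bⱼ` the sum of the `j`-th block. -/
noncomputable def Tan (s : List ℕ) (z : ℂ) : ℂ :=
  ∑ c : Composition s.length,
    (((s.splitWrtComposition c).map (fun b => (1 : ℂ) / (b.length.factorial : ℂ))).prod) *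
      Ten ((s.splitWrtComposition c).map List.sum) z

open Polynomial in
theorem MT_poly (N : ℕ) :
    (X : ℂ[X]) ^ (N+1) ∣ (∑ j ∈ Finset.range N, C ((-1 : ℂ) ^ j / ((j + 1 : ℕ) : ℂ)) * X ^ (j+1)) +
      (∑ j ∈ Finset.range N, C ((-1 : ℂ) ^ j / ((j + 1 : ℕ) : ℂ)) * X ^ (j+1)).comp
        (-(X * ∑ i ∈ Finset.range N, (-X) ^ i)) := by
  set L : ℂ[X] := ∑ j ∈ Finset.range N, C ((-1 : ℂ) ^ j / ((j + 1 : ℕ) : ℂ)) * X ^ (j+1) with hL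
  set W : ℂ[X] := ∑ i ∈ Finset.range N, (-X) ^ i with hW
  have hWX : (1 + X) * W = 1 - (-X) ^ N := by
    have := mul_neg_geom_sum (-X : ℂ[X]) N
    rw [← this]; ring
  have hL' : derivative L = W := by
    rw [hL, hW, derivative_sum]
    refine Finset.sum_congr rfl fun j _ => ?_
    rw [derivative_C_mul, derivative_X_pow, ← mul_assoc, ← C_mul,
      Nat.add_sub_cancel, div_mul_cancel₀ _ (by exact_mod_cast Nat.succ_ne_zero j), neg_pow (X : ℂ[X]), C_pow, C_neg, C_1]
  set V : ℂ[X] := -(X * W) with hV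
  have h1 : (1 + X) * (1 + V) = 1 + X * (-X) ^ N := by
    rw [hV]; linear_combination (-X) * hWX
  have h2 : (1 + V) + (1 + X) * derivative V = (-X) ^ N + X * ((N : ℂ[X]) * (-X) ^ (N-1) * (-1)) := by
    have := congrArg derivative h1
    simp only [derivative_mul, derivative_add, derivative_one, derivative_X, derivative_pow, derivative_neg, zero_add, one_mul, C_eq_natCast] at this
    exact this
  have h3 : W.comp V * (1 + V) = 1 - (-V) ^ N := by
    have := congrArg (fun p : ℂ[X] => p.comp V) hWX
    simp only [mul_comp, add_comp, one_comp, X_comp, sub_comp, pow_comp, neg_comp] at this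
    rw [← this]; ring
  have hd1 : (X : ℂ[X]) ^ N ∣ (-X) ^ N := by rw [neg_pow]; exact dvd_mul_left _ _
  have hd2 : (X : ℂ[X]) ^ N ∣ (-V) ^ N := pow_dvd_pow_of_dvd ⟨W, by rw [hV]; ring⟩ N
  have hd3 : (X : ℂ[X]) ^ N ∣ X * ((N : ℂ[X]) * (-X) ^ (N-1) * (-1)) := by
    rcases N with _ | n
    · simp
    · simp only [Nat.add_sub_cancel]
      refine ⟨(((n+1 : ℕ) : ℂ[X])) * (-1)^n * (-1), ?_⟩
      rw [neg_pow, pow_succ]; ring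
  have hder : (X : ℂ[X]) ^ N ∣ derivative (L + L.comp V) := by
    have e : derivative (L + L.comp V) = W + derivative V * W.comp V := by
      rw [derivative_add, derivative_comp, hL']
    rw [e]
    set Q := W + derivative V * W.comp V
    have e2 : Q = ((-X) ^ N + X * ((N : ℂ[X]) * (-X) ^ (N-1) * (-1))) - (-X)^N * (1 + V)
        - (-V)^N * ((1 + X) * derivative V) - (-X)^N * (X * Q) := by
      linear_combination (-Q) * h1 + (1 + V) * hWX + ((1 + X) * derivative V) * h3 + h2
    rw [e2]
    exact dvd_sub (dvd_sub (dvd_sub (dvd_add hd1 hd3) (hd1.mul_right _)) (hd2.mul_right _)) (hd1.mul_right _)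
  have h0 : (L + L.comp V).coeff 0 = 0 := by
    rw [coeff_zero_eq_eval_zero, eval_add, eval_comp]
    have : L.eval 0 = 0 := by rw [hL, eval_finsetSum]; simp
    rw [this]; simp [hV, this]
  rw [X_pow_dvd_iff] at hder ⊢
  intro d hd
  rcases d with _ | d
  · exact h0
  · have := hder d (by omega)
    rw [coeff_derivative] at this
    have h : (d : ℂ) + 1 ≠ 0 := by exact_mod_cast Nat.succ_ne_zero d
    exact (mul_eq_zero.mp this).resolve_right h

theorem MT_log {E : Type*} [Ring E] [Algebra ℂ E] (N : ℕ) (u v : E) (huv : (1 + u) * (1 + v) = 1)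
    (hvu : (1 + v) * (1 + u) = 1) :
    u ^ (N+1) ∣ (∑ j ∈ Finset.range N, ((-1 : ℂ) ^ j / ((j + 1 : ℕ) : ℂ)) • u ^ (j+1)) +
      ∑ j ∈ Finset.range N, ((-1 : ℂ) ^ j / ((j + 1 : ℕ) : ℂ)) • v ^ (j+1) := by
  open Polynomial in
  have hc : Commute u v := by
    have h : u * v = v * u := by
      have e1 : u * v = (1 + u) * (1 + v) - 1 - u - v := by noncomm_ring
      have e2 : v * u = (1 + v) * (1 + u) - 1 - u - v := by noncomm_ring
      rw [e1, e2, huv, hvu]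
    exact h
  obtain ⟨Q, hQ⟩ := MT_poly N
  have hQ' := congrArg (aeval u) hQ
  set w : E := ∑ i ∈ Finset.range N, (-u) ^ i with hw
  simp only [map_add, map_mul, map_sum, aeval_comp, aeval_C, map_pow, aeval_X, map_neg,
    ← Algebra.smul_def] at hQ'
  rw [← hw] at hQ'
  have hwu : (1 + u) * w = 1 - (-u) ^ N := by
    have := mul_neg_geom_sum (-u) N
    rw [← this, sub_neg_eq_add]
  have hcw : Commute u w := Commute.sum_right _ _ _ fun i _ => ((Commute.refl u).neg_right).pow_right i
  have hcvw : Commute v w := Commute.sum_right _ _ _ fun i _ => (hc.symm.neg_right).pow_right i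
  have key : v - (-(u * w)) = u ^ (N+1) * ((-1) ^ (N+1) * (1 + v)) := by
    have e1 : (1 + u) * (v - (-(u * w))) = - (u * (-u)^N) := by
      have : (1 + u) * (v - (-(u * w))) = ((1+u)*(1+v) - 1) - u + u * ((1 + u) * w) := by noncomm_ring
      rw [this, huv, hwu]; noncomm_ring
    have e2 : v - (-(u * w)) = (1 + v) * (- (u * (-u)^N)) := by
      rw [← e1, ← mul_assoc, hvu, one_mul]
    have e3 : - (u * (-u)^N) = u^(N+1) * (-1)^(N+1) := by
      rw [← neg_mul, ← pow_succ', neg_pow]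
      exact ((Commute.neg_one_left (u^(N+1))).pow_left _).eq
    have e4 : Commute (1 + v) (u^(N+1) * (-1)^(N+1)) := by
      refine Commute.add_left (Commute.one_left _) ?_
      exact ((hc.symm.pow_right _)).mul_right ((Commute.neg_one_right v).pow_right _)
    rw [e2, e3, e4.eq, mul_assoc]
  have hcV : Commute v (-(u * w)) := (hc.symm.mul_right hcvw).neg_right
  have hd : ∀ j, u ^ (N+1) ∣ v ^ j - (-(u*w)) ^ j := fun j =>
    dvd_trans ⟨_, key⟩ (hcV.sub_dvd_pow_sub_pow j)
  have hfin : (∑ j ∈ Finset.range N, ((-1 : ℂ) ^ j / ((j + 1 : ℕ) : ℂ)) • u ^ (j+1)) +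
      ∑ j ∈ Finset.range N, ((-1 : ℂ) ^ j / ((j + 1 : ℕ) : ℂ)) • v ^ (j+1) =
      u ^ (N+1) * aeval u Q + ∑ j ∈ Finset.range N, ((-1 : ℂ) ^ j / ((j + 1 : ℕ) : ℂ)) • (v ^ (j+1) - (-(u*w)) ^ (j+1)) := by
    rw [← hQ']; simp only [smul_sub, Finset.sum_sub_distrib]; abel
  rw [hfin]
  refine dvd_add ⟨_, rfl⟩ (Finset.dvd_sum fun j _ => ?_)
  obtain ⟨c, hc⟩ := hd (j+1)
  exact ⟨((-1 : ℂ) ^ j / ((j + 1 : ℕ) : ℂ)) • c, by rw [hc, mul_smul_comm]⟩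

/-- deconcatenations -/
def MTdc {α : Type} [DecidableEq α] (s : List α) : Finset (List α × List α) :=
  (Finset.range (s.length + 1)).image fun k => (s.take k, s.drop k)

theorem MTmem_dc {α : Type} [DecidableEq α] {s : List α} {p : List α × List α} :
    p ∈ MTdc s ↔ p.1 ++ p.2 = s := by
  simp only [MTdc, Finset.mem_image, Finset.mem_range]
  constructor
  · rintro ⟨k, _, rfl⟩; simp
  · rintro rfl
    exact ⟨p.1.length, by simp, by simp⟩

/-- decompositions in nonempty blocks -/
def MTD (s : List ℕ) : Finset (List (List ℕ)) :=
  Finset.univ.image fun c : Composition s.length => s.splitWrtComposition c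

theorem MTmem_D {s : List ℕ} {d : List (List ℕ)} :
    d ∈ MTD s ↔ d.flatten = s ∧ ∀ b ∈ d, b ≠ [] := by
  simp only [MTD, Finset.mem_image, Finset.mem_univ, true_and]
  constructor
  · rintro ⟨c, rfl⟩
    exact ⟨List.flatten_splitWrtComposition s c, fun b hb =>
      List.length_pos_iff.mp (List.length_pos_of_mem_splitWrtComposition hb)⟩
  · rintro ⟨rfl, h⟩
    refine ⟨⟨d.map List.length, ?_, ?_⟩, List.splitWrtComposition_flatten _ _ rfl⟩
    · intro i hi
      obtain ⟨b, hb, rfl⟩ := List.mem_map.mp hi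
      exact List.length_pos_iff.mpr (h b hb)
    · simp [List.length_flatten]

theorem MTsum_D (s : List ℕ) (F : List (List ℕ) → ℂ) :
    ∑ c : Composition s.length, F (s.splitWrtComposition c) = ∑ d ∈ MTD s, F d := by
  rw [MTD, Finset.sum_image]
  intro c _ c' _ h
  have := congrArg (List.map List.length) h
  simp only [List.map_length_splitWrtComposition] at this
  exact Composition.ext this

def MTδ : List ℕ → ℂ := fun s => if s = [] then 1 else 0

def MTT (A : List ℕ → ℂ) : Module.End ℂ (List ℕ → ℂ) where
  toFun B := fun s => ∑ p ∈ MTdc s, A p.1 * B p.2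
  map_add' B C := by
    funext s; simp [mul_add, Finset.sum_add_distrib]
  map_smul' c B := by
    funext s; simp only [Pi.smul_apply, smul_eq_mul, RingHom.id_apply, Finset.mul_sum]
    exact Finset.sum_congr rfl fun p _ => by ring

theorem MTT_apply (A B : List ℕ → ℂ) (s : List ℕ) :
    MTT A B s = ∑ p ∈ MTdc s, A p.1 * B p.2 := rfl

theorem MTT_sub (A B : List ℕ → ℂ) : MTT (A - B) = MTT A - MTT B := by
  ext C s
  simp [MTT_apply, sub_mul, Finset.sum_sub_distrib]

theorem MTT_δ : MTT MTδ = 1 := by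
  ext B s
  rw [MTT_apply, Finset.sum_eq_single ([], s)]
  · simp [MTδ]
  · rintro ⟨u, v⟩ hp hne
    have := MTmem_dc.mp hp
    have hu : u ≠ [] := by rintro rfl; simp at this; exact hne (by rw [this])
    simp [MTδ, hu]
  · intro h; exact absurd (MTmem_dc.mpr (by simp)) h

theorem MTT_app_δ (A : List ℕ → ℂ) : MTT A MTδ = A := by
  ext s
  rw [MTT_apply, Finset.sum_eq_single (s, [])]
  · simp [MTδ]
  · rintro ⟨u, v⟩ hp hne
    have := MTmem_dc.mp hp
    have hu : v ≠ [] := by rintro rfl; simp at this; exact hne (by rw [this])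
    simp [MTδ, hu]
  · intro h; exact absurd (MTmem_dc.mpr (by simp)) h

theorem MTT_mul (A B : List ℕ → ℂ) : MTT (MTT A B) = MTT A * MTT B := by
  apply LinearMap.ext; intro C; funext s
  simp only [Module.End.mul_apply]
  rw [MTT_apply, MTT_apply]
  simp only [MTT_apply, Finset.sum_mul, Finset.mul_sum]
  rw [Finset.sum_sigma', Finset.sum_sigma']
  refine Finset.sum_bij' (fun x _ => ⟨(x.2.1, x.2.2 ++ x.1.2), (x.2.2, x.1.2)⟩)
    (fun x _ => ⟨(x.1.1 ++ x.2.1, x.2.2), (x.1.1, x.2.1)⟩) ?_ ?_ ?_ ?_ ?_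
  · rintro ⟨⟨a, b⟩, ⟨c, d⟩⟩ h
    simp only [Finset.mem_sigma, MTmem_dc] at h ⊢
    obtain ⟨rfl, rfl⟩ := h
    simp
  · rintro ⟨⟨a, b⟩, ⟨c, d⟩⟩ h
    simp only [Finset.mem_sigma, MTmem_dc] at h ⊢
    obtain ⟨rfl, rfl⟩ := h
    simp
  · rintro ⟨⟨a, b⟩, ⟨c, d⟩⟩ h
    simp only [Finset.mem_sigma, MTmem_dc] at h ⊢
    obtain ⟨rfl, rfl⟩ := h
    rfl
  · rintro ⟨⟨a, b⟩, ⟨c, d⟩⟩ h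
    simp only [Finset.mem_sigma, MTmem_dc] at h ⊢
    obtain ⟨rfl, rfl⟩ := h
    rfl
  · rintro ⟨⟨a, b⟩, ⟨c, d⟩⟩ h
    exact mul_assoc _ _ _

theorem MTT_pow_zero (A : List ℕ → ℂ) (hA : A [] = 0) (j : ℕ) (C : List ℕ → ℂ) (s : List ℕ)
    (hs : s.length < j) : (MTT A ^ j) C s = 0 := by
  induction j generalizing s with
  | zero => omega
  | succ j ih =>
    rw [pow_succ', Module.End.mul_apply, MTT_apply]
    refine Finset.sum_eq_zero ?_
    rintro ⟨u, v⟩ hp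
    have := MTmem_dc.mp hp
    rcases u with _ | ⟨a, u⟩
    · simp [hA]
    · rw [ih v (by rw [← this] at hs; simp at hs; omega), mul_zero]

theorem MTT_pow_eq (A A' : List ℕ → ℂ) (hA : A [] = 0) (hAA : ∀ b, b ≠ [] → A b = A' b)
    (j : ℕ) (s : List ℕ) :
    (MTT A ^ j) MTδ s = ∑ d ∈ MTD s with d.length = j, (d.map A').prod := by
  induction j generalizing s with
  | zero =>
    simp only [pow_zero, Module.End.one_apply, MTδ, List.length_eq_zero_iff]
    split_ifs with h
    · rw [Finset.sum_eq_single []]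
      · simp
      · intro b hb; simp at hb; tauto
      · intro h'; exact absurd (by simp [MTmem_D, h]) h'
    · symm; refine Finset.sum_eq_zero fun d hd => ?_
      simp only [Finset.mem_filter, MTmem_D] at hd
      obtain ⟨⟨h1, _⟩, rfl⟩ := hd
      exact absurd h1.symm h
  | succ j ih =>
    rw [pow_succ', Module.End.mul_apply, MTT_apply]
    have : ∀ p ∈ MTdc s, A p.1 * (MTT A ^ j) MTδ p.2 =
        ∑ d ∈ MTD p.2 with d.length = j, A p.1 * (d.map A').prod := fun p _ => by
      rw [ih, Finset.mul_sum]
    rw [Finset.sum_congr rfl this]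
    have h2 : ∑ p ∈ MTdc s, ∑ d ∈ MTD p.2 with d.length = j, A p.1 * (d.map A').prod =
      ∑ p ∈ MTdc s with p.1 ≠ [], ∑ d ∈ MTD p.2 with d.length = j, A p.1 * (d.map A').prod := by
      symm; apply Finset.sum_filter_of_ne
      intro p _ h he
      apply h; simp [he, hA]
    rw [h2, Finset.sum_sigma']
    refine Finset.sum_bij' (fun x _ => x.1.1 :: x.2) (fun d _ => ⟨(d.headD [], d.tail.flatten), d.tail⟩)
      ?_ ?_ ?_ ?_ ?_
    · rintro ⟨⟨a, b⟩, d⟩ h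
      simp only [Finset.mem_sigma, Finset.mem_filter, MTmem_dc, MTmem_D] at h ⊢
      obtain ⟨⟨rfl, h0⟩, ⟨rfl, h1⟩, h3⟩ := h
      simp [h0, h3]; exact h1
    · rintro d h
      simp only [Finset.mem_sigma, Finset.mem_filter, MTmem_dc, MTmem_D] at h ⊢
      rcases d with _ | ⟨b, d⟩
      · simp at h
      · obtain ⟨⟨rfl, h1⟩, h3⟩ := h
        simp at h1 h3 ⊢
        exact ⟨h1.1, h1.2, h3⟩
    · rintro ⟨⟨a, b⟩, d⟩ h
      simp only [Finset.mem_sigma, Finset.mem_filter, MTmem_dc, MTmem_D] at h ⊢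
      obtain ⟨⟨rfl, h0⟩, ⟨rfl, h1⟩, h3⟩ := h
      rfl
    · rintro d h
      rcases d with _ | ⟨b, d⟩
      · simp at h
      · rfl
    · rintro ⟨⟨a, b⟩, d⟩ h
      simp only [Finset.mem_sigma, Finset.mem_filter] at h
      simp [hAA a h.1.2]

/-- truncated logarithm -/
noncomputable def MTL (N : ℕ) (u : Module.End ℂ (List ℕ → ℂ)) : Module.End ℂ (List ℕ → ℂ) :=
  ∑ j ∈ Finset.range N, ((-1 : ℂ) ^ j / ((j + 1 : ℕ) : ℂ)) • u ^ (j+1)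

noncomputable def MTTen (A : List ℕ → ℂ) (t : List ℕ) : ℂ :=
  ∑ c : Composition t.length,
    ((-1 : ℂ)) ^ (c.length - 1) / (c.length : ℂ) *
      ((t.splitWrtComposition c).map A).prod

noncomputable def MTw (d : List (List ℕ)) : ℂ := (d.map (fun b => (1 : ℂ) / (b.length.factorial : ℂ))).prod

noncomputable def MTTan (A : List ℕ → ℂ) (s : List ℕ) : ℂ :=
  ∑ c : Composition s.length,
    (((s.splitWrtComposition c).map (fun b => (1 : ℂ) / (b.length.factorial : ℂ))).prod) *
      MTTen A ((s.splitWrtComposition c).map List.sum)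

theorem MTD_length {s : List ℕ} {d : List (List ℕ)} (h' : d ∈ MTD s) : d.length ≤ s.length := by
  obtain ⟨rfl, h⟩ := MTmem_D.mp h'
  clear h'
  induction d with
  | nil => simp
  | cons b d ih =>
    have h1 := h b (by simp)
    have := ih (fun b hb => h b (by simp [hb]))
    have := List.length_pos_iff.mpr h1
    simp at *; omega

theorem MTTen_eq (A : List ℕ → ℂ) (hA : A [] = 1) (t : List ℕ) (N : ℕ)
    (hN : t.length ≤ N) : MTTen A t = MTL N (MTT A - 1) MTδ t := by
  have h1 : MTTen A t = ∑ d ∈ MTD t, ((-1 : ℂ)) ^ (d.length - 1) / (d.length : ℂ) * (d.map A).prod := by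
    rw [← MTsum_D, MTTen]
    refine Finset.sum_congr rfl fun c _ => ?_
    rw [List.length_splitWrtComposition]
  rw [h1, ← MTT_δ, ← MTT_sub, MTL]
  simp only [LinearMap.sum_apply, Finset.sum_apply, LinearMap.smul_apply, Pi.smul_apply, smul_eq_mul]
  have h2 : ∀ j ∈ Finset.range N, ((-1 : ℂ) ^ j / ((j + 1 : ℕ) : ℂ)) * (MTT (A - MTδ) ^ (j+1)) MTδ t =
      ∑ d ∈ MTD t with d.length = j + 1, ((-1 : ℂ)) ^ (d.length - 1) / (d.length : ℂ) * (d.map A).prod := by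
    intro j _
    rw [MTT_pow_eq (A - MTδ) A (by simp [hA, MTδ]) (by intro b hb; simp [MTδ, hb]), Finset.mul_sum]
    refine Finset.sum_congr rfl fun d hd => ?_
    rw [(Finset.mem_filter.mp hd).2]; simp
  rw [Finset.sum_congr rfl h2]
  simp only [Finset.sum_filter]
  rw [Finset.sum_comm]
  refine Finset.sum_congr rfl fun d hd => ?_
  have hl := MTD_length hd
  rcases hd0 : d.length with _ | k
  · simp
  · rw [Finset.sum_eq_single k]
    · simp
    · intro j _ hj; rw [if_neg (by omega)]
    · intro h; simp at h; omega

noncomputable def MTR : (List ℕ → ℂ) →ₗ[ℂ] (List ℕ → ℂ) where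
  toFun A := fun s => ∑ d ∈ MTD s, MTw d * A (d.map List.sum)
  map_add' B C := by
    funext s; simp [mul_add, Finset.sum_add_distrib]
  map_smul' c B := by
    funext s; simp only [Pi.smul_apply, smul_eq_mul, RingHom.id_apply, Finset.mul_sum]
    exact Finset.sum_congr rfl fun p _ => by ring

theorem MTR_apply (A : List ℕ → ℂ) (s : List ℕ) :
    MTR A s = ∑ d ∈ MTD s, MTw d * A (d.map List.sum) := rfl

theorem MTR_δ : MTR MTδ = MTδ := by
  funext s
  rw [MTR_apply]
  simp only [MTδ, List.map_eq_nil_iff]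
  split_ifs with h
  · subst h
    rw [Finset.sum_eq_single []]
    · simp [MTw]
    · intro b hb h; simp [h]
    · intro h'; exact absurd (by simp [MTmem_D]) h'
  · refine Finset.sum_eq_zero fun d hd => ?_
    rw [if_neg, mul_zero]
    rintro rfl
    rw [MTmem_D] at hd; exact h hd.1.symm

theorem MTR_T (A B : List ℕ → ℂ) : MTR (MTT A B) = MTT (MTR A) (MTR B) := by
  funext s
  rw [MTR_apply, MTT_apply]
  have h1 : ∀ d ∈ MTD s, MTw d * MTT A B (d.map List.sum) =
      ∑ p ∈ MTdc d, MTw d * (A (p.1.map List.sum) * B (p.2.map List.sum)) := by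
    intro d _
    rw [MTT_apply, Finset.mul_sum]
    symm
    refine Finset.sum_bij (fun p _ => (p.1.map List.sum, p.2.map List.sum)) ?_ ?_ ?_ ?_
    · rintro p hp; rw [MTmem_dc] at hp ⊢; rw [← hp]; simp
    · rintro ⟨a, b⟩ hp ⟨c, e⟩ hq h
      rw [MTmem_dc] at hp hq
      simp only [Prod.mk.injEq] at h
      have hl : a.length = c.length := by have := congrArg List.length h.1; simpa using this
      have := List.append_inj (hp.trans hq.symm) hl
      exact Prod.ext this.1 this.2
    · rintro ⟨a, b⟩ hp
      rw [MTmem_dc] at hp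
      obtain ⟨u, v, rfl, h1, h2⟩ := List.append_eq_map_iff.mp hp
      exact ⟨(u, v), by rw [MTmem_dc], by simp [h1, h2]⟩
    · intros; rfl
  rw [Finset.sum_congr rfl h1, Finset.sum_sigma']
  have h2 : ∀ p ∈ MTdc s, MTR A p.1 * MTR B p.2 =
      ∑ q ∈ MTD p.1 ×ˢ MTD p.2, (MTw q.1 * A (q.1.map List.sum)) * (MTw q.2 * B (q.2.map List.sum)) := by
    intro p _
    rw [MTR_apply, MTR_apply, Finset.sum_mul_sum, Finset.sum_product]
  rw [Finset.sum_congr rfl h2, Finset.sum_sigma']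
  refine Finset.sum_bij' (fun x _ => ⟨(x.2.1.flatten, x.2.2.flatten), x.2⟩) (fun x _ => ⟨x.2.1 ++ x.2.2, x.2⟩) ?_ ?_ ?_ ?_ ?_
  · rintro ⟨d, ⟨a, b⟩⟩ h
    simp only [Finset.mem_sigma, MTmem_dc, MTmem_D, Finset.mem_product] at h ⊢
    obtain ⟨⟨rfl, g1⟩, rfl⟩ := h
    exact ⟨by simp, ⟨trivial, fun x hx => g1 x (by simp [hx])⟩, ⟨trivial, fun x hx => g1 x (by simp [hx])⟩⟩
  · rintro ⟨⟨u, v⟩, ⟨a, b⟩⟩ h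
    simp only [Finset.mem_sigma, MTmem_dc, MTmem_D, Finset.mem_product] at h ⊢
    obtain ⟨rfl, ⟨rfl, g1⟩, ⟨rfl, g2⟩⟩ := h
    refine ⟨⟨by simp, ?_⟩, trivial⟩
    intro x hx
    rcases List.mem_append.mp hx with hx | hx
    exacts [g1 x hx, g2 x hx]
  · rintro ⟨d, ⟨a, b⟩⟩ h
    simp only [Finset.mem_sigma, MTmem_dc] at h ⊢
    obtain ⟨_, rfl⟩ := h; rfl
  · rintro ⟨⟨u, v⟩, ⟨a, b⟩⟩ h
    simp only [Finset.mem_sigma, MTmem_dc, MTmem_D, Finset.mem_product] at h ⊢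
    obtain ⟨rfl, ⟨rfl, h1⟩, ⟨rfl, h2⟩⟩ := h
    rfl
  · rintro ⟨d, ⟨a, b⟩⟩ h
    simp only [Finset.mem_sigma, MTmem_dc] at h ⊢
    obtain ⟨_, rfl⟩ := h
    simp only [MTw, List.map_append, List.prod_append]; ring

theorem MTR_L (A : List ℕ → ℂ) (N : ℕ) :
    MTR (MTL N (MTT A - 1) MTδ) = MTL N (MTT (MTR A) - 1) MTδ := by
  have h : ∀ j : ℕ, MTR (((MTT A - 1) ^ j) MTδ) = ((MTT (MTR A) - 1) ^ j) MTδ := by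
    intro j
    induction j with
    | zero => simp [MTR_δ]
    | succ j ih =>
      rw [pow_succ', pow_succ', Module.End.mul_apply, Module.End.mul_apply, ← ih,
        LinearMap.sub_apply, LinearMap.sub_apply, map_sub, MTR_T]
      rfl
  simp only [MTL, LinearMap.sum_apply, LinearMap.smul_apply, map_sum, map_smul, h]

theorem MTTan_eq (A : List ℕ → ℂ) (hA : A [] = 1) (s : List ℕ) :
    MTTan A s = MTL s.length (MTT (MTR A) - 1) MTδ s := by
  rw [← MTR_L, MTR_apply, ← MTsum_D]
  refine Finset.sum_congr rfl fun c _ => ?_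
  rw [MTTen_eq A hA _ s.length]
  · rfl
  · simp only [List.length_map, List.length_splitWrtComposition]; exact c.length_le

/-- signed reversal -/
def MTρ : (List ℕ → ℂ) →ₗ[ℂ] (List ℕ → ℂ) where
  toFun A := fun s => (-1) ^ s.length * A s.reverse
  map_add' B C := by
    funext s; simp [mul_add]
  map_smul' c B := by
    funext s; simp only [Pi.smul_apply, smul_eq_mul, RingHom.id_apply]; ring

theorem MTρ_apply (A : List ℕ → ℂ) (s : List ℕ) : MTρ A s = (-1) ^ s.length * A s.reverse := rfl

theorem MTρ_δ : MTρ MTδ = MTδ := by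
  funext s; rw [MTρ_apply]; rcases s with _ | ⟨a, s⟩ <;> simp [MTδ]

theorem MTρ_T (A B : List ℕ → ℂ) : MTρ (MTT A B) = MTT (MTρ B) (MTρ A) := by
  funext s
  rw [MTρ_apply, MTT_apply, MTT_apply, Finset.mul_sum]
  refine Finset.sum_bij' (fun p _ => (p.2.reverse, p.1.reverse)) (fun p _ => (p.2.reverse, p.1.reverse)) ?_ ?_ ?_ ?_ ?_
  · rintro ⟨a, b⟩ h
    rw [MTmem_dc] at h ⊢
    simp only at h ⊢
    rw [← List.reverse_append, h, List.reverse_reverse]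
  · rintro ⟨a, b⟩ h
    rw [MTmem_dc] at h ⊢
    simp only at h ⊢
    rw [← List.reverse_append, h]
  · rintro ⟨a, b⟩ h; simp
  · rintro ⟨a, b⟩ h; simp
  · rintro ⟨a, b⟩ h
    rw [MTmem_dc] at h
    have : s.length = a.length + b.length := by
      have := congrArg List.length h; simp at this; omega
    simp only [MTρ_apply, List.length_reverse, List.reverse_reverse, this]; ring

theorem MTρ_L (A : List ℕ → ℂ) (N : ℕ) :
    MTρ (MTL N (MTT A - 1) MTδ) = MTL N (MTT (MTρ A) - 1) MTδ := by
  have hT : ∀ (A : List ℕ → ℂ) j, MTT ((MTT A ^ j) MTδ) = MTT A ^ j := by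
    intro A j
    induction j with
    | zero => simp [MTT_δ]
    | succ j ih => rw [pow_succ', Module.End.mul_apply, MTT_mul, ih]
  have h : ∀ (A : List ℕ → ℂ) j, MTρ ((MTT A ^ j) MTδ) = (MTT (MTρ A) ^ j) MTδ := by
    intro A j
    induction j with
    | zero => simp [MTρ_δ]
    | succ j ih =>
      rw [pow_succ', Module.End.mul_apply, MTρ_T, ih, hT, pow_succ, Module.End.mul_apply, MTT_app_δ]
  have e : MTT (MTρ A) - 1 = MTT (MTρ (A - MTδ)) := by rw [map_sub, MTρ_δ, MTT_sub, MTT_δ]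
  rw [e, ← MTT_δ, ← MTT_sub]
  simp only [MTL, LinearMap.sum_apply, LinearMap.smul_apply, map_sum, map_smul, h]

/-- finite ordered truncation -/
def MTA : List ℂ → List ℕ → ℂ
  | [] => MTδ
  | x :: L => MTT (fun s => match s with | [] => 1 | [a] => x ^ a | _ => 0) (MTA L)

theorem MTA_nil (L : List ℂ) : MTA L [] = 1 := by
  induction L with
  | nil => simp [MTA, MTδ]
  | cons x L ih =>
    rw [MTA, MTT_apply]
    simp [MTdc, ih]

theorem MTA_cons (x : ℂ) (L : List ℂ) (a : ℕ) (s : List ℕ) :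
    MTA (x :: L) (a :: s) = MTA L (a :: s) + x ^ a * MTA L s := by
  rw [MTA, MTT_apply, Finset.sum_eq_add_of_mem ([], a :: s) ([a], s)]
  · simp
  · rw [MTmem_dc]; rfl
  · rw [MTmem_dc]; rfl
  · simp
  · rintro ⟨u, v⟩ h ⟨h1, h2⟩
    rw [MTmem_dc] at h
    rcases u with _ | ⟨b, _ | ⟨c, u⟩⟩
    · simp at h; exact absurd (by simp [h]) h1
    · simp at h; exact absurd (by simp [h]) h2
    · simp

noncomputable def MTe (x : ℂ) (s : List ℕ) : ℂ := x ^ s.sum / (s.length.factorial : ℂ)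

theorem MTR_e (x : ℂ) :
    MTR (fun s => match s with | [] => 1 | [a] => x ^ a | _ => 0) = MTe x := by
  funext s
  rw [MTR_apply]
  rcases s with _ | ⟨a, s⟩
  · rw [Finset.sum_eq_single []]
    · simp [MTw, MTe]
    · intro b hb hne
      rw [MTmem_D] at hb
      rcases b with _ | ⟨c, b⟩
      · simp at hne
      · exfalso; apply hb.2 c (by simp)
        have := hb.1; simp at this; exact this.1
    · intro h'; exact absurd (by simp [MTmem_D]) h'
  · rw [Finset.sum_eq_single [a :: s]]
    · simp [MTw, MTe]; ring
    · intro b hb hne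
      rw [MTmem_D] at hb
      rcases b with _ | ⟨c, _ | ⟨c', b⟩⟩
      · simp at hb
      · have := hb.1; simp at this; exact absurd (by rw [this]) hne
      · simp
    · intro h'; exact absurd (by simp [MTmem_D]) h'

theorem MTsum_dc (s : List ℕ) (F : List ℕ × List ℕ → ℂ) :
    ∑ p ∈ MTdc s, F p = ∑ k ∈ Finset.range (s.length + 1), F (s.take k, s.drop k) := by
  rw [MTdc, Finset.sum_image]
  intro k hk k' hk' h
  simp only [Prod.mk.injEq] at h
  have := congrArg List.length h.1
  simp at this hk hk'
  omega

theorem MTbinom (n : ℕ) : ∑ k ∈ Finset.range (n + 1),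
    (1 / (k.factorial : ℂ)) * ((-1) ^ (n - k) / ((n-k).factorial : ℂ)) = if n = 0 then 1 else 0 := by
  have h := add_pow (1 : ℂ) (-1) n
  have h2 : ∑ k ∈ Finset.range (n + 1),
    (1 / (k.factorial : ℂ)) * ((-1) ^ (n - k) / ((n-k).factorial : ℂ)) =
      (1 + (-1)) ^ n / (n.factorial : ℂ) := by
    rw [h, Finset.sum_div]
    refine Finset.sum_congr rfl fun k hk => ?_
    have hk' : k ≤ n := by simp at hk; omega
    rw [Nat.cast_choose ℂ hk']
    have := Nat.cast_ne_zero (R := ℂ).mpr (Nat.factorial_ne_zero n)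
    have := Nat.cast_ne_zero (R := ℂ).mpr (Nat.factorial_ne_zero k)
    have := Nat.cast_ne_zero (R := ℂ).mpr (Nat.factorial_ne_zero (n-k))
    field_simp
    simp
  rw [h2]
  rcases n with _ | n <;> simp

theorem MTe_inv (x : ℂ) : MTT (MTe x) (MTρ (MTe x)) = MTδ := by
  funext s
  rw [MTT_apply, MTsum_dc]
  have : ∀ k ∈ Finset.range (s.length + 1), MTe x (s.take k) * MTρ (MTe x) (s.drop k) =
      x ^ s.sum * ((1 / (k.factorial : ℂ)) * ((-1) ^ (s.length - k) / ((s.length-k).factorial : ℂ))) := by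
    intro k hk
    have hk' : k ≤ s.length := by simp at hk; omega
    have hsum : s.sum = (s.take k).sum + (s.drop k).sum := by
      rw [← List.sum_append, List.take_append_drop]
    simp only [MTρ_apply, MTe, List.sum_reverse, List.length_reverse, List.length_take, List.length_drop,
      min_eq_left hk']
    rw [hsum, pow_add]; ring
  rw [Finset.sum_congr rfl this, ← Finset.mul_sum, MTbinom]
  rcases s with _ | ⟨a, s⟩ <;> simp [MTδ]

theorem MTe_inv' (x : ℂ) : MTT (MTρ (MTe x)) (MTe x) = MTδ := by
  funext s
  rw [MTT_apply, MTsum_dc]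
  rw [← Finset.sum_range_reflect]
  have : ∀ k ∈ Finset.range (s.length + 1), MTρ (MTe x) (s.take (s.length + 1 - 1 - k)) * (MTe x) (s.drop (s.length + 1 - 1 - k)) =
      x ^ s.sum * ((1 / (k.factorial : ℂ)) * ((-1) ^ (s.length - k) / ((s.length-k).factorial : ℂ))) := by
    intro k hk
    have hk' : k ≤ s.length := by simp at hk; omega
    have hsum : s.sum = (s.take (s.length - k)).sum + (s.drop (s.length - k)).sum := by
      rw [← List.sum_append, List.take_append_drop]
    have e : s.length - (s.length - k) = k := by omega
    simp only [MTρ_apply, MTe, List.sum_reverse, List.length_reverse, List.length_take, List.length_drop,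
      Nat.add_sub_cancel, min_eq_left (Nat.sub_le s.length k), e]
    rw [hsum, pow_add]; ring
  rw [Finset.sum_congr rfl this, ← Finset.mul_sum, MTbinom]
  rcases s with _ | ⟨a, s⟩ <;> simp [MTδ]

theorem MTRA_inv (L : List ℂ) : MTT (MTR (MTA L)) * MTT (MTρ (MTR (MTA L))) = 1 ∧
    MTT (MTρ (MTR (MTA L))) * MTT (MTR (MTA L)) = 1 := by
  induction L with
  | nil => simp [MTA, MTR_δ, MTρ_δ, MTT_δ]
  | cons x L ih =>
    rw [MTA, MTR_T, MTR_e, MTρ_T, MTT_mul, MTT_mul]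
    have h1 : MTT (MTe x) * MTT (MTρ (MTe x)) = 1 := by rw [← MTT_mul, MTe_inv, MTT_δ]
    have h2 : MTT (MTρ (MTe x)) * MTT (MTe x) = 1 := by rw [← MTT_mul, MTe_inv', MTT_δ]
    constructor
    · rw [mul_assoc, ← mul_assoc (MTT (MTR (MTA L))), ih.1, one_mul, h1]
    · rw [mul_assoc, ← mul_assoc (MTT (MTρ (MTe x))), h2, one_mul, ih.2]

theorem MTR_nil (A : List ℕ → ℂ) : MTR A [] = A [] := by
  rw [MTR_apply, Finset.sum_eq_single []]
  · simp [MTw]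
  · intro b hb hne
    rw [MTmem_D] at hb
    rcases b with _ | ⟨c, b⟩
    · simp at hne
    · exfalso; apply hb.2 c (by simp)
      have := hb.1; simp at this; exact this.1
  · intro h'; exact absurd (by simp [MTmem_D]) h'

theorem MTTanA_rev (L : List ℂ) (s : List ℕ) (hr : 1 ≤ s.length) :
    MTTan (MTA L) s.reverse = (-1) ^ (s.length - 1) * MTTan (MTA L) s := by
  rw [MTTan_eq _ (MTA_nil L), MTTan_eq _ (MTA_nil L), List.length_reverse]
  have h := MTRA_inv L
  have hρ := congrFun (MTρ_L (MTR (MTA L)) s.length) s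
  rw [MTρ_apply] at hρ
  set B := MTR (MTA L) with hB
  have hd := MT_log s.length (MTT B - 1) (MTT (MTρ B) - 1) (by simpa using h.1) (by simpa using h.2)
  obtain ⟨Q, hQ⟩ := hd
  have h0 : (MTL s.length (MTT B - 1) + MTL s.length (MTT (MTρ B) - 1)) MTδ s = 0 := by
    unfold MTL
    rw [hQ, Module.End.mul_apply, ← MTT_δ, ← MTT_sub, MTT_pow_zero]
    · simp [hB, MTR_nil, MTA_nil, MTδ]
    · omega
  rw [LinearMap.add_apply, Pi.add_apply, ← hρ] at h0
  obtain ⟨n, hn⟩ : ∃ n, s.length = n + 1 := ⟨s.length - 1, by omega⟩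
  have hs : ((-1 : ℂ) ^ n) * (-1) ^ n = 1 := by rw [← mul_pow]; simp
  rw [hn] at h0 ⊢
  simp only [Nat.add_sub_cancel]
  rw [pow_succ] at h0
  linear_combination -(-1 : ℂ) ^ n * h0 - (MTL (n+1) (MTT B - 1) MTδ s.reverse) * hs

/-- descending list of the values at `a+k-1, …, a` -/
noncomputable def MTlist (z : ℂ) (a : ℤ) : ℕ → List ℂ
  | 0 => []
  | k+1 => (((a + k : ℤ) : ℂ) + z)⁻¹ :: MTlist z a k

noncomputable def MTQ (a : ℤ) (k r : ℕ) : Finset (Fin r → ℤ) :=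
  (Fintype.piFinset fun _ : Fin r => Finset.Ico a (a + k)).filter fun n => ∀ i j, i < j → n j < n i

theorem MTQ_zero (a : ℤ) (k : ℕ) : MTQ a k 0 = {fun i => Fin.elim0 i} := by
  ext n
  have : n = fun i => Fin.elim0 i := funext fun i => Fin.elim0 i
  simp [MTQ, this]
  exact funext fun i => Fin.elim0 i

theorem MTQ_sum0 (a : ℤ) (k : ℕ) (f : (Fin 0 → ℤ) → Fin 0 → ℂ) :
    1 = ∑ n ∈ MTQ a k 0, ∏ i : Fin 0, f n i := by
  rw [MTQ_zero]; simp

theorem MTQ_sum (z : ℂ) (a : ℤ) (k : ℕ) (s : List ℕ) :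
    MTA (MTlist z a k) s = ∑ n ∈ MTQ a k s.length, ∏ i : Fin s.length, ((n i : ℂ) + z) ^ (-(s.get i : ℤ)) := by
  induction k generalizing s with
  | zero =>
    rcases s with _ | ⟨b, s⟩
    · simp only [MTlist, MTA_nil]
      exact MTQ_sum0 a _ _
    · have : MTQ a 0 (b :: s).length = ∅ := by
        ext n; simp only [MTQ, Finset.mem_filter, Fintype.mem_piFinset, Finset.notMem_empty, iff_false]
        rintro ⟨h, _⟩
        have := h ⟨0, by simp⟩
        simp at this
      rw [this]; simp [MTlist, MTA, MTδ]
  | succ k ih =>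
    rcases s with _ | ⟨b, s⟩
    · simp only [MTA_nil]
      exact MTQ_sum0 a _ _
    · rw [MTlist, MTA_cons, ih, ih]
      simp only [List.length_cons]
      rw [← Finset.sum_filter_add_sum_filter_not (MTQ a (k+1) (s.length + 1)) (fun n => n 0 < a + k)]
      congr 1
      · refine Finset.sum_congr ?_ fun _ _ => rfl
        ext n
        simp only [MTQ, Finset.mem_filter, Fintype.mem_piFinset, Finset.mem_Ico]
        constructor
        · rintro ⟨h1, h2⟩
          exact ⟨⟨fun i => ⟨(h1 i).1, by have := (h1 i).2; push_cast; omega⟩, h2⟩, (h1 0).2⟩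
        · rintro ⟨⟨h1, h2⟩, h3⟩
          refine ⟨fun i => ⟨(h1 i).1, ?_⟩, h2⟩
          rcases Fin.eq_zero_or_eq_succ i with rfl | ⟨j, rfl⟩
          · exact h3
          · have := h2 0 j.succ (Fin.succ_pos j); omega
      · rw [Finset.mul_sum]
        refine Finset.sum_bij' (fun n _ => Fin.cons (a + k : ℤ) n) (fun n _ => Fin.tail n) ?_ ?_ ?_ ?_ ?_
        · intro n hn
          simp only [MTQ, Finset.mem_filter, Fintype.mem_piFinset, Finset.mem_Ico] at hn ⊢
          obtain ⟨h1, h2⟩ := hn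
          refine ⟨⟨fun i => ?_, fun i j hij => ?_⟩, by simp⟩
          · refine Fin.cases ?_ (fun i => ?_) i
            · simp
            · have := h1 i; simp; omega
          · rcases Fin.eq_zero_or_eq_succ j with rfl | ⟨j, rfl⟩
            · exact absurd hij (Fin.not_lt_zero i)
            · rcases Fin.eq_zero_or_eq_succ i with rfl | ⟨i, rfl⟩
              · have := h1 j; simp; omega
              · simpa using h2 i j (Fin.succ_lt_succ_iff.mp hij)
        · intro n hn
          simp only [MTQ, Finset.mem_filter, Fintype.mem_piFinset, Finset.mem_Ico] at hn ⊢
          obtain ⟨⟨h1, h2⟩, h3⟩ := hn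
          refine ⟨fun i => ⟨(h1 i.succ).1, ?_⟩, fun i j hij => h2 _ _ (Fin.succ_lt_succ_iff.mpr hij)⟩
          have := h2 0 i.succ (Fin.succ_pos i)
          have := (h1 0).2
          simp only [Fin.tail]; push_cast at this; omega
        · intro n hn; simp
        · intro n hn
          simp only [MTQ, Finset.mem_filter, Fintype.mem_piFinset, Finset.mem_Ico] at hn
          have h0 : n 0 = a + k := by
            have := (hn.1.1 0).2; push_cast at this; have := hn.2; omega
          rw [← h0]; exact Fin.cons_self_tail n
        · intro n hn
          rw [Fin.prod_univ_succ]
          simp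

theorem MTsummable1 (z : ℂ) (k : ℕ) (hk : 2 ≤ k) :
    Summable fun n : ℤ => ‖((n : ℂ) + z) ^ (-(k : ℤ))‖ := by
  have := (EisensteinSeries.linear_right_summable z 1 (k := k) (by exact_mod_cast hk)).norm
  refine this.congr fun n => ?_
  rw [zpow_neg]; simp [add_comm]

theorem MTsummable (z : ℂ) (s : List ℕ) (hs : ∀ x ∈ s, 2 ≤ x) :
    Summable fun n : Fin s.length → ℤ => ∏ i : Fin s.length, ((n i : ℂ) + z) ^ (-(s.get i : ℤ)) := by
  apply Summable.of_norm
  refine summable_of_sum_le (c := ∏ i : Fin s.length, ∑' m : ℤ, ‖((m : ℂ) + z) ^ (-(s.get i : ℤ))‖)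
    (fun _ => norm_nonneg _) fun u => ?_
  classical
  set K : Finset ℤ := u.biUnion fun n => Finset.univ.image n
  calc ∑ n ∈ u, ‖∏ i : Fin s.length, ((n i : ℂ) + z) ^ (-(s.get i : ℤ))‖
      ≤ ∑ n ∈ Fintype.piFinset (fun _ : Fin s.length => K), ‖∏ i : Fin s.length, ((n i : ℂ) + z) ^ (-(s.get i : ℤ))‖ := by
        refine Finset.sum_le_sum_of_subset_of_nonneg ?_ fun _ _ _ => norm_nonneg _
        intro n hn
        rw [Fintype.mem_piFinset]
        intro i
        exact Finset.mem_biUnion.mpr ⟨n, hn, by simp⟩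
    _ = ∏ i : Fin s.length, ∑ m ∈ K, ‖((m : ℂ) + z) ^ (-(s.get i : ℤ))‖ := by
        simp only [norm_prod]
        exact Finset.sum_prod_piFinset K (fun i m => ‖((m : ℂ) + z) ^ (-(s.get i : ℤ))‖)
    _ ≤ _ := by
        refine Finset.prod_le_prod (fun _ _ => Finset.sum_nonneg fun _ _ => norm_nonneg _) fun i _ => ?_
        exact (MTsummable1 z _ (hs _ (List.get_mem s i))).sum_le_tsum _ fun _ _ => norm_nonneg _

open Filter Topology in
theorem MTA_tendsto (z : ℂ) (s : List ℕ) (hs : ∀ x ∈ s, 2 ≤ x) :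
    Tendsto (fun N : ℕ => MTA (MTlist z (-(N : ℤ)) (2 * N + 1)) s) atTop (𝓝 (Te s z)) := by
  set f : (Fin s.length → ℤ) → ℂ := fun n => ∏ i : Fin s.length, ((n i : ℂ) + z) ^ (-(s.get i : ℤ)) with hf
  have h1 : HasSum (fun n : {n : Fin s.length → ℤ // StrictAnti n} => f n.1) (Te s z) :=
    ((MTsummable z s hs).subtype {n | StrictAnti n}).hasSum
  have h2 := (hasSum_subtype_iff_indicator (s := {n : Fin s.length → ℤ | StrictAnti n}) (f := f)).mp h1
  have h3 : Tendsto (fun N : ℕ => Fintype.piFinset fun _ : Fin s.length => Finset.Ico (-(N : ℤ)) (-(N:ℤ) + ((2 * N + 1 : ℕ) : ℤ))) atTop atTop := by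
    refine tendsto_atTop_finset_of_monotone ?_ ?_
    · intro M N h n hn
      simp only [Fintype.mem_piFinset, Finset.mem_Ico] at hn ⊢
      intro i; have := hn i; push_cast at *; omega
    · intro n
      refine ⟨∑ i, (n i).natAbs, ?_⟩
      simp only [Fintype.mem_piFinset, Finset.mem_Ico]
      intro i
      have := Finset.single_le_sum (f := fun i => (n i).natAbs) (fun _ _ => Nat.zero_le _) (Finset.mem_univ i)
      generalize (∑ i, (n i).natAbs) = S at *
      push_cast; omega
  refine (Tendsto.comp h2 h3).congr fun N => ?_
  rw [MTQ_sum]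
  classical
  simp only [Function.comp, MTQ, Finset.sum_filter]
  refine Finset.sum_congr rfl fun n _ => ?_
  rw [Set.indicator_apply]
  exact if_congr ⟨fun h i j hij => h hij, fun h i j hij => h i j hij⟩ rfl rfl

open Filter Topology in
theorem MTTen_tendsto (F : ℕ → List ℕ → ℂ) (A : List ℕ → ℂ)
    (h : ∀ s : List ℕ, (∀ x ∈ s, 2 ≤ x) → Tendsto (fun N => F N s) atTop (𝓝 (A s)))
    (t : List ℕ) (ht : ∀ x ∈ t, 2 ≤ x) :
    Tendsto (fun N => MTTen (F N) t) atTop (𝓝 (MTTen A t)) := by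
  refine tendsto_finsetSum _ fun c _ => Tendsto.const_mul _ ?_
  refine tendsto_list_prod (f := fun b N => F N b) _ fun b hb => h b fun x hx => ht x ?_
  rw [← List.flatten_splitWrtComposition t c]
  exact List.mem_flatten.mpr ⟨b, hb, hx⟩

open Filter Topology in
theorem MTTan_tendsto (F : ℕ → List ℕ → ℂ) (A : List ℕ → ℂ)
    (h : ∀ s : List ℕ, (∀ x ∈ s, 2 ≤ x) → Tendsto (fun N => F N s) atTop (𝓝 (A s)))
    (s : List ℕ) (ht : ∀ x ∈ s, 2 ≤ x) :
    Tendsto (fun N => MTTan (F N) s) atTop (𝓝 (MTTan A s)) := by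
  refine tendsto_finsetSum _ fun c _ => Tendsto.const_mul _ (MTTen_tendsto F A h _ ?_)
  intro x hx
  obtain ⟨b, hb, rfl⟩ := List.mem_map.mp hx
  have h0 := List.length_pos_of_mem_splitWrtComposition hb
  obtain ⟨y, hy⟩ := List.exists_mem_of_length_pos h0
  refine (ht y ?_).trans (List.le_sum_of_mem hy)
  rw [← List.flatten_splitWrtComposition s c]
  exact List.mem_flatten.mpr ⟨b, hb, hy⟩

/-- Reversal antisymmetry of alternal multitangents:
`Tan^{s_r,…,s₁}(z) = (−1)^{r−1} · Tan^{s₁,…,s_r}(z)`. -/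
theorem Tan_reversal_antisymmetry
    (s : List ℕ) (hr : 1 ≤ s.length) (hs : ∀ x ∈ s, 2 ≤ x)
    (z : ℂ) (hz : ∀ n : ℤ, z ≠ (n : ℂ)) :
    Tan s.reverse z = (-1 : ℂ) ^ (s.length - 1) * Tan s z := by
  have h1 := MTTan_tendsto _ (fun t => Te t z) (MTA_tendsto z) s hs
  have h2 := MTTan_tendsto _ (fun t => Te t z) (MTA_tendsto z) s.reverse (by simpa using hs)
  have h3 := h1.const_mul ((-1 : ℂ) ^ (s.length - 1))
  refine tendsto_nhds_unique (h2.congr fun N => ?_) h3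
  exact MTTanA_rev _ s hr
end

section
/- Parity separation of alternal multitangents: let r ≥ 1 and let (s_1,…,s_r) be integers all ≥ 2, and set d_i := s_i − 1. Then for every z ∈ ℂ ∖ ℤ, Tan^{s_1,…,s_r}(−z) = (−1)^{1 + d_1 + ⋯ + d_r} · Tan^{s_1,…,s_r}(z); in other words Tan^{s_1,…,s_r} is an even function when d_1+⋯+d_r is odd and an odd function when d_1+⋯+d_r is even. -/
def Mould : Type := List ℕ → ℂ
noncomputable section
namespace Mould

instance : AddCommGroup Mould := inferInstanceAs (AddCommGroup (List ℕ → ℂ))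
instance : Module ℂ Mould := inferInstanceAs (Module ℂ (List ℕ → ℂ))

@[ext] theorem ext {M N : Mould} (h : ∀ s, M s = N s) : M = N := funext h
@[simp] theorem add_ap (M N : Mould) (s : List ℕ) : (M + N) s = M s + N s := rfl
@[simp] theorem sub_ap (M N : Mould) (s : List ℕ) : (M - N) s = M s - N s := rfl
@[simp] theorem neg_ap (M : Mould) (s : List ℕ) : (-M) s = - M s := rfl
@[simp] theorem zero_ap (s : List ℕ) : (0 : Mould) s = 0 := rfl
@[simp] theorem smul_ap (c : ℂ) (M : Mould) (s : List ℕ) : (c • M) s = c * M s := rfl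

def sh (M : Mould) (a : ℕ) : Mould := fun u => M (a :: u)
@[simp] theorem sh_ap (M : Mould) (a : ℕ) (u : List ℕ) : M.sh a u = M (a :: u) := rfl

def conv : List ℕ → Mould → Mould → ℂ
  | [], M, G => M [] * G []
  | (a :: t), M, G => M [] * G (a :: t) + conv t (M.sh a) G

instance : Mul Mould := ⟨fun M G s => conv s M G⟩
instance : One Mould := ⟨fun s => if s = [] then 1 else 0⟩

@[simp] theorem mul_nil (M N : Mould) : (M * N) [] = M [] * N [] := rfl
theorem mul_cons (M N : Mould) (a : ℕ) (t : List ℕ) :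
    (M * N) (a :: t) = M [] * N (a :: t) + (M.sh a * N) t := rfl
@[simp] theorem one_nil : (1 : Mould) [] = 1 := rfl
@[simp] theorem one_cons (a : ℕ) (t : List ℕ) : (1 : Mould) (a :: t) = 0 := rfl

theorem sh_add (M N : Mould) (a : ℕ) : (M + N).sh a = M.sh a + N.sh a := rfl
theorem sh_smul (c : ℂ) (M : Mould) (a : ℕ) : (c • M).sh a = c • M.sh a := rfl
theorem sh_zero (a : ℕ) : (0 : Mould).sh a = 0 := rfl
theorem sh_one (a : ℕ) : (1 : Mould).sh a = 0 := rfl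
theorem sh_mul (M N : Mould) (a : ℕ) : (M * N).sh a = M [] • N.sh a + M.sh a * N := rfl

theorem add_mul' (M N G : Mould) : (M + N) * G = M * G + N * G := by
  ext s
  induction s generalizing M N with
  | nil => simp [add_mul]
  | cons a t ih => simp [mul_cons, sh_add, ih, add_mul]; ring
theorem mul_add' (M N G : Mould) : M * (N + G) = M * N + M * G := by
  ext s
  induction s generalizing M with
  | nil => simp [mul_add]
  | cons a t ih => simp only [add_ap] at ih; simp [mul_cons, ih, mul_add]; ring
theorem smul_mul' (c : ℂ) (M G : Mould) : (c • M) * G = c • (M * G) := by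
  ext s
  induction s generalizing M with
  | nil => simp [mul_assoc]
  | cons a t ih => simp [mul_cons, sh_smul, ih, mul_add, mul_assoc]
theorem mul_smul' (c : ℂ) (M G : Mould) : M * (c • G) = c • (M * G) := by
  ext s
  induction s generalizing M with
  | nil => simp; ring
  | cons a t ih => simp only [smul_ap] at ih; simp [mul_cons, ih, mul_add]; ring
theorem zero_mul' (M : Mould) : 0 * M = 0 := by
  ext s
  induction s with
  | nil => simp
  | cons a t ih => simp [mul_cons, sh_zero, ih]
theorem mul_zero' (M : Mould) : M * 0 = 0 := by
  ext s
  induction s generalizing M with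
  | nil => simp
  | cons a t ih => simp only [zero_ap] at ih; simp [mul_cons, ih]
theorem one_mul' (M : Mould) : 1 * M = M := by
  ext s
  cases s with
  | nil => simp
  | cons a t => simp [mul_cons, sh_one, zero_mul']
theorem mul_one' (M : Mould) : M * 1 = M := by
  ext s
  induction s generalizing M with
  | nil => simp
  | cons a t ih => simp [mul_cons, ih]
theorem mul_assoc' (M N G : Mould) : M * N * G = M * (N * G) := by
  ext s
  induction s generalizing M with
  | nil => simp [mul_assoc]
  | cons a t ih =>
    rw [mul_cons, mul_cons, sh_mul, add_mul', smul_mul', add_ap, ih, mul_cons]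
    simp; ring

instance : Ring Mould :=
  { (inferInstance : AddCommGroup Mould) with
    mul := (· * ·)
    one := 1
    mul_assoc := mul_assoc'
    one_mul := one_mul'
    mul_one := mul_one'
    left_distrib := mul_add'
    right_distrib := add_mul'
    zero_mul := zero_mul'
    mul_zero := mul_zero' }

instance : Algebra ℂ Mould := Algebra.ofModule smul_mul' mul_smul'

theorem sum_ap {ι : Type*} (S : Finset ι) (f : ι → Mould) (s : List ℕ) :
    (∑ i ∈ S, f i) s = ∑ i ∈ S, f i s := Finset.sum_apply s S f

/-- agreement up to length r -/
theorem mul_congr {r : ℕ} {M M' N N' : Mould} (h : ∀ s, s.length ≤ r → M s = M' s)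
    (h' : ∀ s, s.length ≤ r → N s = N' s) : ∀ s, s.length ≤ r → (M * N) s = (M' * N') s := by
  intro s
  induction s generalizing M M' r with
  | nil => intro hs; simp [h [] hs, h' [] hs]
  | cons a t ih =>
    intro hs
    rw [mul_cons, mul_cons, h [] (by simp), h' _ hs]
    obtain ⟨r, rfl⟩ : ∃ q, r = q + 1 := ⟨r - 1, by simp at hs; omega⟩
    rw [ih (r := r) (M' := M'.sh a)]
    · intro s hs; exact h _ (by simpa using hs)
    · intro s hs; exact h' _ (by omega)
    · simpa using hs

theorem pow_congr {r : ℕ} {M M' : Mould} (h : ∀ s, s.length ≤ r → M s = M' s) (k : ℕ) :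
    ∀ s, s.length ≤ r → (M ^ k) s = (M' ^ k) s := by
  induction k with
  | zero => simp
  | succ k ih => rw [pow_succ, pow_succ]; exact mul_congr ih h

theorem pow_vanish {x : Mould} (hx : x [] = 0) (k : ℕ) (s : List ℕ) (hs : s.length < k) :
    (x ^ k) s = 0 := by
  induction k generalizing s with
  | zero => omega
  | succ k ih =>
    rw [pow_succ']
    cases s with
    | nil => simp [hx]
    | cons a t =>
      rw [mul_cons, hx, zero_mul, zero_add]
      rw [mul_congr (r := t.length) (M' := x.sh a) (N' := 0) (fun _ _ => rfl) _ t le_rfl]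
      · simp
      · intro u hu; exact ih u (by simp at hs; omega)

def lc (k : ℕ) : ℂ := (-1 : ℂ) ^ (k - 1) / (k : ℂ)

open Polynomial in
def Lp (r : ℕ) : ℂ[X] := ∑ k ∈ Finset.range (r + 1), C (lc k) * X ^ k
open Polynomial in
def yp (r : ℕ) : ℂ[X] := ∑ k ∈ Finset.range r, (-X) ^ (k + 1)

open Polynomial in
theorem yp_spec (r : ℕ) : (1 + X) * (1 + yp r) = 1 - (-X) ^ (r + 1) := by
  have h := mul_neg_geom_sum (-X : ℂ[X]) (r + 1)
  rw [Finset.sum_range_succ'] at h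
  rw [yp, ← h]; ring

open Polynomial in
theorem Lp_der (r : ℕ) : (1 + X) * derivative (Lp r) = 1 - (-X) ^ r := by
  have h := mul_neg_geom_sum (-X : ℂ[X]) r
  rw [← h, sub_neg_eq_add]
  congr 1
  rw [Lp, Finset.sum_range_succ']
  simp only [derivative_add, derivative_sum]
  simp only [lc, pow_zero, mul_one, derivative_C, add_zero]
  refine Finset.sum_congr rfl fun k _ => ?_
  rw [derivative_C_mul, derivative_X_pow]
  have : ((k + 1 : ℕ) : ℂ) ≠ 0 := by exact_mod_cast Nat.succ_ne_zero k
  rw [← mul_assoc, ← C_mul, div_mul_cancel₀ _ this]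
  simp only [Nat.add_sub_cancel]
  rw [neg_pow (X : ℂ[X]) k]; simp

open Polynomial in
theorem Lp_dvd (r : ℕ) : X ^ (r + 1) ∣ Lp r + (Lp r).comp (yp r) := by
  set H := Lp r + (Lp r).comp (yp r) with hH
  set y := yp r with hy
  have hyX : X ∣ y := by
    rw [hy, yp]; refine Finset.dvd_sum fun k _ => ?_
    rw [pow_succ]; exact Dvd.dvd.mul_left (by simp) _
  have h1 : (1 + y) * (derivative (Lp r)).comp y = 1 - (-y) ^ r := by
    have := congrArg (fun p => p.comp y) (Lp_der r)
    simpa using this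
  have h2 : X ^ r ∣ (1 + y) + (1 + X) * derivative y := by
    have := congrArg derivative (yp_spec r)
    rw [← hy] at this
    simp only [derivative_mul, derivative_add, derivative_one, derivative_X, zero_add, one_mul,
      derivative_sub] at this
    rw [this, neg_pow, derivative_mul, derivative_X_pow]
    refine ⟨-(-1)^(r+1) * C ((r + 1 : ℕ) : ℂ), ?_⟩
    have h0 : derivative ((-1 : ℂ[X]) ^ (r + 1)) = 0 := by
      rw [derivative_pow]; simp
    rw [h0]; simp; ring
  have h3 : X ^ r ∣ ((1 + X) * (1 + y)) * derivative H := by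
    have e : ((1 + X) * (1 + y)) * derivative H
        = ((1 + y) + (1 + X) * derivative y) - (1 + y) * (-X) ^ r
          - (1 + X) * derivative y * (-y) ^ r := by
      rw [hH, derivative_add, derivative_comp]
      linear_combination (1 + y) * Lp_der r + (1 + X) * derivative y * h1
    rw [e]
    refine dvd_sub (dvd_sub h2 ?_) ?_
    · exact Dvd.dvd.mul_left (pow_dvd_pow_of_dvd (by simp) r) _
    · exact Dvd.dvd.mul_left (pow_dvd_pow_of_dvd (by simpa using hyX) r) _
  have h4 : X ^ r ∣ derivative H := by
    have : X ^ r ∣ ((1 + X) * (1 + y)) * derivative H + (-X) ^ (r + 1) * derivative H := by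
      refine dvd_add h3 (Dvd.dvd.mul_right ?_ _)
      rw [pow_succ]
      exact Dvd.dvd.mul_right (pow_dvd_pow_of_dvd (by simp) r) _
    rw [yp_spec] at this
    convert this using 1
    ring
  rw [X_pow_dvd_iff] at h4 ⊢
  intro d hd
  cases d with
  | zero =>
    have hy0 : y.coeff 0 = 0 := X_dvd_iff.1 hyX
    have hl : (Lp r).eval 0 = 0 := by
      rw [Lp, eval_finsetSum]
      refine Finset.sum_eq_zero fun k _ => ?_
      cases k <;> simp [lc]
    rw [coeff_zero_eq_eval_zero] at hy0 ⊢
    rw [hH, eval_add, eval_comp, hy0, hl, add_zero]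
  | succ d =>
    have := h4 d (by omega)
    rw [coeff_derivative] at this
    have h' : ((d : ℂ) + 1) ≠ 0 := by exact_mod_cast Nat.succ_ne_zero d
    exact (mul_eq_zero.1 this).resolve_right h'

def lg (r : ℕ) (P : Mould) : Mould := ∑ k ∈ Finset.range (r + 1), lc k • (P - 1) ^ k

open Polynomial in
theorem lg_eq (r : ℕ) (x : Mould) : aeval x (Lp r) = lg r (1 + x) := by
  simp [Lp, lg, Algebra.smul_def]

theorem lg_congr {r : ℕ} {M M' : Mould} (h : ∀ s, s.length ≤ r → M s = M' s) :
    ∀ s, s.length ≤ r → (lg r M) s = (lg r M') s := by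
  intro s hs
  simp only [lg, sum_ap, smul_ap]
  refine Finset.sum_congr rfl fun k _ => ?_
  rw [pow_congr (M' := M' - 1) (r := r) _ k s hs]
  intro u hu; simp [h u hu]

open Polynomial in
theorem lg_inv (r : ℕ) (P Q : Mould) (hP : P [] = 1) (hPQ : P * Q = 1) (s : List ℕ)
    (hs : s.length ≤ r) : lg r Q s = - lg r P s := by
  set x : Mould := P - 1 with hx
  have hx0 : x [] = 0 := by simp [hx, hP]
  have hPx : 1 + x = P := by simp [hx]
  have e1 : (1 + aeval x (yp r)) * P = 1 - (-x) ^ (r + 1) := by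
    have := congrArg (aeval x) (yp_spec r)
    rw [mul_comm] at this
    simpa [hPx] using this
  have e2 : ∀ u : List ℕ, u.length ≤ r → (1 + aeval x (yp r)) u = Q u := by
    intro u hu
    have : 1 + aeval x (yp r) = (1 - (-x) ^ (r + 1)) * Q := by
      rw [← e1, mul_assoc, hPQ, mul_one]
    rw [this, mul_congr (r := r) (M' := 1) (N' := Q) _ (fun _ _ => rfl) u hu, one_mul]
    intro v hv
    rw [sub_ap, pow_vanish (by simp [hx0]) _ _ (by omega), sub_zero]
  rw [← lg_congr e2 s hs, ← lg_eq, ← hPx, ← lg_eq]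
  obtain ⟨q, hq⟩ := Lp_dvd r
  have := congrArg (aeval x) hq
  rw [map_add, aeval_comp, map_mul, map_pow, aeval_X] at this
  have h := congrArg (fun M : Mould => M s) this
  simp only [add_ap] at h
  rw [mul_congr (r := r) (M' := 0) (N' := aeval x q) _ (fun _ _ => rfl) s hs, zero_mul] at h
  · rw [zero_ap] at h; linear_combination h
  · intro v hv; exact pow_vanish hx0 _ _ (by omega)

end Mould
end
noncomputable section
namespace Mould

/-- decompositions, first block starting with `b` -/
def decsK : List ℕ → List ℕ → List (List (List ℕ))
  | b, [] => [[b]]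
  | b, (a :: t) => decsK (b ++ [a]) t ++ (decsK [a] t).map (fun l => b :: l)

def decs : List ℕ → List (List (List ℕ))
  | [] => [[]]
  | (a :: t) => decsK [a] t

theorem mem_decsK (t b : List ℕ) (l : List (List ℕ)) :
    l ∈ decsK b t ↔ ∃ c m, l = (b ++ c) :: m ∧ c ++ m.flatten = t ∧ [] ∉ m := by
  induction t generalizing b l with
  | nil =>
    simp only [decsK, List.mem_singleton]
    constructor
    · rintro rfl; exact ⟨[], [], by simp⟩
    · rintro ⟨c, m, rfl, h, hm⟩
      obtain ⟨rfl, h⟩ := List.append_eq_nil_iff.1 h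
      cases m with
      | nil => simp
      | cons d m => simp at h; simp [h.1] at hm
  | cons a t ih =>
    simp only [decsK, List.mem_append, List.mem_map, ih]
    constructor
    · rintro (⟨c, m, rfl, rfl, hm⟩ | ⟨l, ⟨c, m, rfl, rfl, hm⟩, rfl⟩)
      · exact ⟨a :: c, m, by simp, by simp, hm⟩
      · exact ⟨[], (a :: c) :: m, by simp, by simp, by simp [hm]⟩
    · rintro ⟨c, m, rfl, h, hm⟩
      cases c with
      | cons x c =>
        simp at h
        obtain ⟨rfl, rfl⟩ := h
        exact Or.inl ⟨c, m, by simp, rfl, hm⟩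
      | nil =>
        cases m with
        | nil => simp at h
        | cons d m =>
          cases d with
          | nil => simp at hm
          | cons x d =>
            simp at h
            obtain ⟨rfl, rfl⟩ := h
            exact Or.inr ⟨(x :: d) :: m, ⟨d, m, by simp, rfl, by simpa using hm⟩, by simp⟩

theorem nodup_decsK (t b : List ℕ) : (decsK b t).Nodup := by
  induction t generalizing b with
  | nil => simp [decsK]
  | cons a t ih =>
    rw [decsK, List.nodup_append]
    refine ⟨ih _, (ih _).map (fun x y h => by simpa using h), ?_⟩
    intro x hx y hy hxy
    subst hxy
    obtain ⟨c, m, rfl, -, -⟩ := (mem_decsK _ _ _).1 hx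
    simp at hy

theorem mem_decs (t : List ℕ) (l : List (List ℕ)) :
    l ∈ decs t ↔ l.flatten = t ∧ [] ∉ l := by
  cases t with
  | nil =>
    simp only [decs, List.mem_singleton]
    constructor
    · rintro rfl; simp
    · rintro ⟨h, hm⟩
      cases l with
      | nil => rfl
      | cons d m => simp at h; simp [h.1] at hm
  | cons a t =>
    simp only [decs, mem_decsK]
    constructor
    · rintro ⟨c, m, rfl, rfl, hm⟩; simp [hm]
    · rintro ⟨h, hm⟩
      cases l with
      | nil => simp at h
      | cons d m =>
        cases d with
        | nil => simp at hm
        | cons x d =>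
          simp at h
          obtain ⟨rfl, rfl⟩ := h
          exact ⟨d, m, by simp, rfl, by simpa using hm⟩

theorem nodup_decs (t : List ℕ) : (decs t).Nodup := by
  cases t with
  | nil => simp [decs]
  | cons a t => exact nodup_decsK _ _

theorem sum_comp (s : List ℕ) (F : List (List ℕ) → ℂ) :
    ∑ c : Composition s.length, F (s.splitWrtComposition c) = ((decs s).map F).sum := by
  rw [← List.sum_toFinset _ (nodup_decs s)]
  refine Finset.sum_bij (fun c _ => s.splitWrtComposition c) ?_ ?_ ?_ (fun _ _ => rfl)
  · intro c _
    rw [List.mem_toFinset, mem_decs]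
    refine ⟨List.flatten_splitWrtComposition _ _, fun h => ?_⟩
    simpa using List.length_pos_of_mem_splitWrtComposition h
  · intro c _ c' _ h
    have := congrArg (List.map List.length) h
    rw [List.map_length_splitWrtComposition, List.map_length_splitWrtComposition] at this
    exact Composition.ext this
  · intro l hl
    rw [List.mem_toFinset, mem_decs] at hl
    obtain ⟨rfl, hl⟩ := hl
    refine ⟨⟨l.map List.length, ?_, ?_⟩, Finset.mem_univ _, ?_⟩
    · intro i hi
      obtain ⟨x, hx, rfl⟩ := List.mem_map.1 hi
      refine List.length_pos_of_ne_nil ?_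
      rintro rfl; exact hl hx
    · simp
    · exact List.splitWrtComposition_flatten _ _ rfl

/-- shift by a word -/
def shw (M : Mould) (b : List ℕ) : Mould := fun u => M (b ++ u)

theorem pow_nil (x : Mould) (k : ℕ) : (x ^ k) [] = (x []) ^ k := by
  induction k with
  | zero => simp
  | succ k ih => rw [pow_succ, pow_succ, mul_nil, ih]

theorem prod_nil (M : Mould) : (List.map M []).prod = 1 := rfl
theorem prod_cons (M : Mould) (b : List ℕ) (l : List (List ℕ)) :
    (List.map M (b :: l)).prod = M b * (List.map M l).prod := List.prod_cons

theorem decsK_pow (M : Mould) (hM : M [] = 1) (t b : List ℕ) (hb : b ≠ []) (k : ℕ) :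
    ((decsK b t).map (fun l => if l.length = k + 1 then (l.map M).prod else 0)).sum
      = ((M - 1).shw b * (M - 1) ^ k) t := by
  have hone : ∀ b : List ℕ, b ≠ [] → (1 : Mould) b = 0 := by
    intro b hb; cases b <;> simp at hb ⊢
  induction t generalizing b k with
  | nil =>
    rw [mul_nil, pow_nil]
    simp only [decsK, shw, sub_ap, hM, one_nil, sub_self, List.append_nil, hone b hb]
    cases k <;> simp [prod_cons, prod_nil]
  | cons a t ih =>
    rw [mul_cons]
    have e1 : ((M - 1).shw b).sh a = (M - 1).shw (b ++ [a]) := by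
      ext u; simp [shw]
    rw [e1, ← ih _ (by simp), decsK, List.map_append, List.sum_append, add_comm]
    congr 1
    rw [List.map_map]
    have e2 : (M - 1).shw b [] = M b := by simp [shw, hone b hb]
    rw [e2]
    cases k with
    | zero =>
      rw [pow_zero, one_cons, mul_zero]
      refine List.sum_eq_zero fun x hx => ?_
      obtain ⟨l, hl, rfl⟩ := List.mem_map.1 hx
      obtain ⟨c, m, rfl, -, -⟩ := (mem_decsK _ _ _).1 hl
      simp
    | succ k =>
      rw [pow_succ', mul_cons]
      have e3 : (M - 1) [] = 0 := by simp [hM]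
      have e4 : (M - 1).sh a = (M - 1).shw [a] := by ext u; simp [shw]
      rw [e3, zero_mul, zero_add, e4, ← ih _ (by simp), ← List.sum_map_mul_left]
      congr 1
      refine List.map_congr_left fun l _ => ?_
      simp [prod_cons]

theorem decs_pow (M : Mould) (hM : M [] = 1) (t : List ℕ) (k : ℕ) :
    ((decs t).map (fun l => if l.length = k then (l.map M).prod else 0)).sum
      = ((M - 1) ^ k) t := by
  cases t with
  | nil =>
    rw [pow_nil]
    cases k <;> simp [decs, hM, prod_nil]
  | cons a t =>
    cases k with
    | zero =>
      rw [pow_zero, one_cons]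
      refine List.sum_eq_zero fun x hx => ?_
      obtain ⟨l, hl, rfl⟩ := List.mem_map.1 hx
      obtain ⟨c, m, rfl, -, -⟩ := (mem_decsK _ _ _).1 hl
      simp
    | succ k =>
      have e3 : (M - 1) [] = 0 := by simp [hM]
      have e4 : (M - 1).sh a = (M - 1).shw [a] := by ext u; simp [shw]
      rw [pow_succ', mul_cons, e3, zero_mul, zero_add, e4, ← decsK_pow M hM _ _ (by simp), decs]

theorem len_le_flatten (l : List (List ℕ)) (h : [] ∉ l) : l.length ≤ l.flatten.length := by
  induction l with
  | nil => simp
  | cons d m ih =>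
    simp at h
    have h1 := ih h.2
    have h2 : 0 < d.length := List.length_pos_of_ne_nil h.1
    simp only [List.length_cons, List.flatten_cons, List.length_append]; omega

theorem decs_lg (M : Mould) (hM : M [] = 1) (t : List ℕ) (r : ℕ) (hr : t.length ≤ r) :
    ((decs t).map (fun l => lc l.length * (l.map M).prod)).sum = lg r M t := by
  simp only [lg, sum_ap, smul_ap, ← decs_pow M hM, ← List.sum_map_mul_left]
  rw [← List.sum_toFinset _ (nodup_decs t)]
  simp only [← List.sum_toFinset _ (nodup_decs t)]
  rw [Finset.sum_comm]
  refine Finset.sum_congr rfl fun l hl => ?_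
  rw [List.mem_toFinset, mem_decs] at hl
  have := len_le_flatten l hl.2
  rw [hl.1] at this
  simp only [mul_ite, mul_zero]
  rw [Finset.sum_ite_eq, if_pos (Finset.mem_range.2 (by omega))]

/-- composition with `E-1` -/
def wt (l : List (List ℕ)) : ℂ := (l.map (fun b => (1 : ℂ) / (b.length.factorial : ℂ))).prod
def K (M : Mould) (b : List ℕ) : Mould := fun t =>
  ((decsK b t).map (fun l => wt l * M (l.map List.sum))).sum
def Co (M : Mould) : Mould := fun s => ((decs s).map (fun l => wt l * M (l.map List.sum))).sum

theorem Co_nil (M : Mould) : Co M [] = M [] := by simp [Co, decs, wt]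
theorem Co_sh (M : Mould) (a : ℕ) : (Co M).sh a = K M [a] := rfl
theorem Co_cons (M : Mould) (a : ℕ) (t : List ℕ) : (Co M) (a :: t) = K M [a] t := rfl
theorem K_nil (M : Mould) (b : List ℕ) :
    K M b [] = 1 / (b.length.factorial : ℂ) * M [b.sum] := by simp [K, decsK, wt]
theorem K_sh (M : Mould) (b : List ℕ) (a : ℕ) :
    (K M b).sh a = K M (b ++ [a]) + (1 / (b.length.factorial : ℂ)) • K (M.sh b.sum) [a] := by
  ext t
  simp only [sh_ap, add_ap, smul_ap, K, decsK, List.map_append, List.sum_append, List.map_map,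
    ← List.sum_map_mul_left]
  congr 2
  refine List.map_congr_left fun l _ => ?_
  simp [wt, mul_assoc]
theorem K_cons (M : Mould) (b : List ℕ) (a : ℕ) (t : List ℕ) :
    K M b (a :: t) = K M (b ++ [a]) t + (1 / (b.length.factorial : ℂ)) * K (M.sh b.sum) [a] t :=
  congrArg (fun M : Mould => M t) (K_sh M b a)
theorem K_add (M N : Mould) (b : List ℕ) : K (M + N) b = K M b + K N b := by
  ext t; simp [K, mul_add, List.sum_map_add]
theorem K_smul (c : ℂ) (M : Mould) (b : List ℕ) : K (c • M) b = c • K M b := by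
  ext t; simp only [K, smul_ap, ← List.sum_map_mul_left]; congr 2; ext l; ring
theorem Co_add (M N : Mould) : Co (M + N) = Co M + Co N := by
  ext t; simp [Co, mul_add, List.sum_map_add]
theorem Co_smul (c : ℂ) (M : Mould) : Co (c • M) = c • Co M := by
  ext t; simp only [Co, smul_ap, ← List.sum_map_mul_left]; congr 2; ext l; ring

theorem K_mul (M N : Mould) (b : List ℕ) : K (M * N) b = M [] • K N b + K M b * Co N := by
  ext t
  induction t generalizing M b with
  | nil => simp [K_nil, mul_cons, Co_nil]; ring
  | cons a t ih =>
    rw [K_cons, sh_mul, K_add, K_smul]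
    simp only [add_ap, smul_ap] at ih ⊢
    rw [ih, ih, mul_cons, K_sh, K_nil, K_cons, Co_cons, add_mul, smul_mul']
    simp; ring

theorem Co_mul (M N : Mould) : Co (M * N) = Co M * Co N := by
  ext s
  cases s with
  | nil => simp [Co_nil]
  | cons a t => rw [Co_cons, K_mul, mul_cons, Co_nil, Co_cons, Co_sh]; simp

theorem Co_one : Co 1 = 1 := by
  ext s
  cases s with
  | nil => simp [Co_nil]
  | cons a t =>
    rw [Co_cons, one_cons]
    refine List.sum_eq_zero fun x hx => ?_
    obtain ⟨l, hl, rfl⟩ := List.mem_map.1 hx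
    obtain ⟨c, m, rfl, -, -⟩ := (mem_decsK _ _ _).1 hl
    rw [List.map_cons, one_cons, mul_zero]

def CoL : Mould →ₐ[ℂ] Mould :=
  AlgHom.ofLinearMap
    { toFun := Co, map_add' := Co_add, map_smul' := Co_smul } Co_one Co_mul

theorem Co_lg (r : ℕ) (M : Mould) : Co (lg r M) = lg r (Co M) := by
  change CoL (lg r M) = lg r (CoL M)
  simp [lg, map_sum]

/-- sign automorphism -/
def sg (M : Mould) : Mould := fun s => (-1 : ℂ) ^ (s.sum + s.length) * M s
def sgc (c : ℕ) (M : Mould) : Mould := fun s => (-1 : ℂ) ^ (c + (s.sum + s.length)) * M s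
theorem sg_mul (M N : Mould) : sg (M * N) = sg M * sg N := by
  ext s
  have key : ∀ (c : ℕ) (M : Mould), (-1 : ℂ) ^ (c + (s.sum + s.length)) * (M * N) s
      = (sgc c M * sg N) s := by
    induction s with
    | nil => intro c M; simp [sg, sgc, mul_assoc]
    | cons a t ih =>
      intro c M
      have := ih (c + a + 1) (M.sh a)
      rw [mul_cons, mul_cons, mul_add]
      have e : c + ((a :: t).sum + (a :: t).length) = (c + a + 1) + (t.sum + t.length) := by
        simp; ring
      rw [e, this]
      congr 1
      · simp [sg, sgc]; ring
      · have e5 : sgc (c + a + 1) (M.sh a) = (sgc c M).sh a := by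
          ext u
          simp only [sh_ap, sgc]
          congr 2
          simp; ring
        rw [e5]
  have h0 : sgc 0 M = sg M := by ext u; simp [sgc, sg]
  simpa [sg, h0] using key 0 M

def sgL : Mould →ₐ[ℂ] Mould :=
  AlgHom.ofLinearMap
    { toFun := sg
      map_add' := fun M N => by ext s; simp [sg, mul_add]
      map_smul' := fun c M => by ext s; simp [sg]; ring }
    (by ext s; cases s <;> simp [sg]) sg_mul

theorem sg_lg (r : ℕ) (M : Mould) : sg (lg r M) = lg r (sg M) := by
  change sgL (lg r M) = lg r (sgL M)
  simp [lg, map_sum]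

/-- elementary factors -/
def Xm (w : ℕ → ℂ) : Mould
  | [a] => w a
  | _ => 0
def Em (w : ℕ → ℂ) (c : ℂ) : Mould := fun s => c ^ s.length * w s.sum / (s.length.factorial : ℂ)

theorem Xm_sh (w : ℕ → ℂ) (a : ℕ) : (Xm w).sh a = w a • 1 := by
  ext s; cases s <;> simp [Xm]

theorem K_one (b : List ℕ) : K 1 b = 0 := by
  ext t
  refine List.sum_eq_zero fun x hx => ?_
  obtain ⟨l, hl, rfl⟩ := List.mem_map.1 hx
  obtain ⟨c, m, rfl, -, -⟩ := (mem_decsK _ _ _).1 hl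
  rw [List.map_cons, one_cons, mul_zero]

theorem K_Xm (w : ℕ → ℂ) (b t : List ℕ) : K (Xm w) b t = Em w 1 (b ++ t) := by
  induction t generalizing b with
  | nil => simp [K_nil, Xm, Em]; ring
  | cons a t ih => rw [K_cons, ih, Xm_sh, K_smul, K_one]; simp

theorem Co_Xm (w : ℕ → ℂ) (h0 : w 0 = 1) : Co (1 + Xm w) = Em w 1 := by
  ext s
  cases s with
  | nil => simp [Co_nil, Xm, Em, h0]
  | cons a t => rw [Co_cons, K_add, K_one, add_ap, K_Xm]; simp

theorem mul_antidiag (M N : Mould) (s : List ℕ) :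
    (M * N) s = ∑ p ∈ Finset.HasAntidiagonal.antidiagonal s.length, M (s.take p.1) * N (s.drop p.1) := by
  induction s generalizing M with
  | nil => simp
  | cons a t ih =>
    rw [mul_cons, ih, List.length_cons, Finset.Nat.antidiagonal_succ]
    simp

theorem Em_mul (w : ℕ → ℂ) (h0 : w 0 = 1) (h : ∀ a b, w (a + b) = w a * w b) :
    Em w 1 * Em w (-1) = 1 := by
  ext s
  rw [mul_antidiag]
  have key := congrArg (PowerSeries.coeff s.length) (PowerSeries.exp_mul_exp_neg_eq_one (A := ℂ))
  rw [PowerSeries.coeff_mul] at key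
  have : ∀ p ∈ Finset.HasAntidiagonal.antidiagonal s.length, Em w 1 (s.take p.1) * Em w (-1) (s.drop p.1)
      = w s.sum * (PowerSeries.coeff p.1 (PowerSeries.exp ℂ) *
        PowerSeries.coeff p.2 (PowerSeries.evalNegHom (PowerSeries.exp ℂ))) := by
    intro p hp
    have hp' := Finset.HasAntidiagonal.mem_antidiagonal.1 hp
    have e1 : (s.take p.1).length = p.1 := by simp; omega
    have e2 : (s.drop p.1).length = p.2 := by simp; omega
    have e3 : s.sum = (s.take p.1).sum + (s.drop p.1).sum := by
      rw [← List.sum_append, List.take_append_drop]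
    simp only [Em, e1, e2]
    rw [e3, h]
    simp [PowerSeries.evalNegHom, PowerSeries.coeff_rescale, PowerSeries.coeff_exp]
    ring
  rw [Finset.sum_congr rfl this, ← Finset.mul_sum, key]
  cases s with
  | nil => simp [h0]
  | cons a t => simp [PowerSeries.coeff_one]

/-- ordered products -/
def Pr (f : ℤ → Mould) (lo : ℤ) : ℕ → Mould
  | 0 => 1
  | m + 1 => f (lo + m) * Pr f lo m

theorem Pr_right (f : ℤ → Mould) (lo : ℤ) (m : ℕ) : Pr f lo (m + 1) = Pr f (lo + 1) m * f lo := by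
  induction m generalizing lo with
  | zero => simp [Pr]
  | succ m ih =>
    rw [Pr, ih, Pr, ← mul_assoc]
    congr 3; push_cast; ring

theorem Pr_inv (f g : ℤ → Mould) (h : ∀ n, f n * g (-n) = 1) (lo : ℤ) (m : ℕ) :
    Pr f lo m * Pr g (1 - lo - m) m = 1 := by
  induction m with
  | zero => simp [Pr]
  | succ m ih =>
    rw [Pr_right g, Pr]
    have e : (1 - lo - ((m + 1 : ℕ) : ℤ)) + 1 = 1 - lo - m := by push_cast; ring
    have e' : (1 - lo - ((m + 1 : ℕ) : ℤ)) = - (lo + m) := by push_cast; ring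
    rw [e, e', mul_assoc, ← mul_assoc (Pr f lo m), ih, one_mul, h]

theorem Pr_map (F : Mould → Mould) (h1 : F 1 = 1) (hm : ∀ M N, F (M * N) = F M * F N)
    (f : ℤ → Mould) (lo : ℤ) (m : ℕ) : F (Pr f lo m) = Pr (fun n => F (f n)) lo m := by
  induction m with
  | zero => simpa [Pr]
  | succ m ih => rw [Pr, hm, ih, Pr]

theorem Pr_nil (f : ℤ → Mould) (h : ∀ n, f n [] = 1) (lo : ℤ) (m : ℕ) : Pr f lo m [] = 1 := by
  induction m with
  | zero => simp [Pr]
  | succ m ih => rw [Pr, mul_nil, h, ih, one_mul]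

/-- truncated multitangents -/
def wz (z : ℂ) (n : ℤ) (a : ℕ) : ℂ := ((n : ℂ) + z) ^ (-(a : ℤ))
def TN (z : ℂ) (lo : ℤ) (m : ℕ) : Mould := Pr (fun n => 1 + Xm (wz z n)) lo m

theorem wz_zero (z : ℂ) (n : ℤ) : wz z n 0 = 1 := by simp [wz]
theorem wz_add (z : ℂ) (n : ℤ) (a b : ℕ) : wz z n (a + b) = wz z n a * wz z n b := by
  simp only [wz, zpow_neg, zpow_natCast]
  rw [pow_add, mul_inv]
theorem wz_neg (z : ℂ) (n : ℤ) (a : ℕ) : wz (-z) n a = (-1) ^ a * wz z (-n) a := by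
  have : (n : ℂ) + -z = (-1) * (((-n : ℤ) : ℂ) + z) := by push_cast; ring
  simp only [wz, zpow_neg, zpow_natCast]
  rw [this, mul_pow, mul_inv]
  congr 1
  rw [← inv_pow]; norm_num

theorem TN_nil (z : ℂ) (lo : ℤ) (m : ℕ) : TN z lo m [] = 1 :=
  Pr_nil _ (fun n => by simp [Xm]) _ _

theorem Co_TN (z : ℂ) (lo : ℤ) (m : ℕ) :
    Co (TN z lo m) = Pr (fun n => Em (wz z n) 1) lo m := by
  rw [TN, Pr_map Co Co_one Co_mul]
  simp only [Co_Xm _ (wz_zero z _)]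

theorem sg_Em (z : ℂ) (n : ℤ) : sg (Em (wz (-z) n) 1) = Em (wz z (-n)) (-1) := by
  ext s
  simp only [sg, Em, wz_neg, pow_add]
  have : (-1 : ℂ) ^ s.sum * (-1) ^ s.sum = 1 := by rw [← mul_pow]; simp
  simp
  linear_combination (-1 : ℂ) ^ s.length * wz z (-n) s.sum / s.length.factorial * this

theorem trunc_parity (z : ℂ) (N : ℕ) (r : ℕ) (s : List ℕ) (hs : s.length ≤ r) :
    (-1 : ℂ) ^ (s.sum + s.length) * Co (lg r (TN (-z) (-N) (2 * N + 1))) s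
      = - Co (lg r (TN z (-N) (2 * N + 1))) s := by
  change sg (Co (lg r (TN (-z) (-N) (2 * N + 1)))) s = _
  rw [Co_lg, Co_lg, sg_lg]
  apply lg_inv _ _ _ _ _ _ hs
  · rw [Co_nil, TN_nil]
  · rw [Co_TN, Co_TN, Pr_map sg (map_one sgL) sg_mul]
    simp only [sg_Em]
    have := Pr_inv (fun n => Em (wz z n) 1) (fun n => Em (wz z (-n)) (-1))
      (fun n => by simpa using Em_mul _ (wz_zero z n) (wz_add z n)) (-N) (2 * N + 1)
    convert this using 3
    push_cast; ring

theorem Ten_eq (t : List ℕ) (z : ℂ) : Ten t z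
    = ((decs t).map (fun l => lc l.length * (l.map (fun b => Te b z)).prod)).sum := by
  rw [← sum_comp, Ten]
  simp [lc]

theorem Tan_eq (s : List ℕ) (z : ℂ) : Tan s z
    = ((decs s).map (fun l => wt l * Ten (l.map List.sum) z)).sum := by
  rw [← sum_comp, Tan]
  simp only [wt]
end Mould
end
noncomputable section
namespace Mould

def AF (lo : ℤ) : ℕ → (k : ℕ) → Finset (Fin k → ℤ)
  | _, 0 => Finset.univ
  | 0, _ + 1 => ∅
  | m + 1, k + 1 => AF lo m (k + 1) ∪
      (AF lo m k).image (fun f => (Fin.cons (lo + (m : ℤ)) f : Fin (k + 1) → ℤ))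

theorem sA_cons (k : ℕ) (x : ℤ) (f : Fin k → ℤ) :
    StrictAnti (Fin.cons x f : Fin (k + 1) → ℤ) ↔ (∀ i, f i < x) ∧ StrictAnti f := by
  constructor
  · intro h
    refine ⟨fun i => by simpa using h (Fin.succ_pos i), fun i j hij => ?_⟩
    simpa using h (Fin.succ_lt_succ_iff.2 hij)
  · rintro ⟨h1, h2⟩ i j hij
    induction j using Fin.cases with
    | zero => exact absurd hij (Fin.not_lt_zero _)
    | succ j =>
      induction i using Fin.cases with
      | zero => simpa using h1 j
      | succ i => simpa using h2 (Fin.succ_lt_succ_iff.1 hij)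

theorem mem_AF (lo : ℤ) (m k : ℕ) (f : Fin k → ℤ) :
    f ∈ AF lo m k ↔ StrictAnti f ∧ ∀ i, lo ≤ f i ∧ f i < lo + m := by
  induction m generalizing k with
  | zero =>
    cases k with
    | zero => exact ⟨fun _ => ⟨Subsingleton.strictAnti f, fun i => i.elim0⟩, fun _ => by simp [AF, Unique.eq_default]⟩
    | succ k =>
      simp only [AF, Finset.notMem_empty, false_iff]
      rintro ⟨-, h⟩
      have := h 0
      simp at this; omega
  | succ m ih =>
    cases k with
    | zero => exact ⟨fun _ => ⟨Subsingleton.strictAnti f, fun i => i.elim0⟩, fun _ => by simp [AF, Unique.eq_default]⟩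
    | succ k =>
      simp only [AF, Finset.mem_union, Finset.mem_image, ih]
      constructor
      · rintro (⟨h, h'⟩ | ⟨g, ⟨h, h'⟩, rfl⟩)
        · exact ⟨h, fun i => ⟨(h' i).1, by have := (h' i).2; push_cast; omega⟩⟩
        · refine ⟨(sA_cons _ _ _).2 ⟨fun i => (h' i).2, h⟩, fun i => ?_⟩
          induction i using Fin.cases with
          | zero => simp
          | succ i => have := h' i; simp; omega
      · rintro ⟨h, h'⟩
        by_cases h0 : f 0 = lo + m
        · right
          have e : (Fin.cons (lo + (m : ℤ)) (Fin.tail f) : Fin (k + 1) → ℤ) = f := by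
            rw [← h0]; exact Fin.cons_self_tail f
          rw [← e, sA_cons] at h
          exact ⟨Fin.tail f, ⟨h.2, fun i => ⟨(h' i.succ).1, h.1 i⟩⟩, e⟩
        · left
          refine ⟨h, fun i => ⟨(h' i).1, ?_⟩⟩
          have h1 : f i ≤ f 0 := h.antitone (Fin.zero_le i)
          have h2 := (h' 0).2
          push_cast at h2; omega

theorem TN_eq (z : ℂ) (lo : ℤ) (m : ℕ) (t : List ℕ) :
    TN z lo m t = ∑ f ∈ AF lo m t.length, ∏ i, wz z (f i) (t.get i) := by
  induction m generalizing t with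
  | zero =>
    cases t with
    | nil => simp [AF, TN, Pr]
    | cons a t => simp [AF, TN, Pr]
  | succ m ih =>
    cases t with
    | nil => rw [TN_nil]; simp [AF]
    | cons a t =>
      have : TN z lo (m + 1) = (1 + Xm (wz z (lo + m))) * TN z lo m := rfl
      rw [this, mul_cons, sh_add, sh_one, Xm_sh, zero_add, smul_mul', one_mul, smul_ap, ih, ih]
      simp only [List.length_cons, AF]
      rw [Finset.sum_union, Finset.sum_image]
      · congr 1
        · simp [Xm]
        · rw [Finset.mul_sum]
          refine Finset.sum_congr rfl fun f _ => ?_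
          rw [Fin.prod_univ_succ]
          simp
      · intro f _ g _ h
        exact Fin.cons_right_injective _ h
      · rw [Finset.disjoint_left]
        intro f hf hf'
        obtain ⟨g, -, rfl⟩ := Finset.mem_image.1 hf'
        have := (((mem_AF _ _ _ _).1 hf).2 0).2
        simp at this

theorem summable_wz (z : ℂ) (a : ℕ) (ha : 2 ≤ a) : Summable (fun n : ℤ => ‖wz z n a‖) := by
  have := (EisensteinSeries.linear_right_summable z 1 (k := a) (by exact_mod_cast ha)).norm
  refine this.congr fun n => ?_
  simp [wz, zpow_neg, add_comm]

theorem summable_Te (z : ℂ) (t : List ℕ) (ht : ∀ x ∈ t, 2 ≤ x) :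
    Summable (fun f : {f : Fin t.length → ℤ // StrictAnti f} => ∏ i, wz z (f.1 i) (t.get i)) := by
  refine Summable.of_norm ?_
  have : Summable (fun f : Fin t.length → ℤ => ‖∏ i, wz z (f i) (t.get i)‖) := by
    refine summable_of_sum_le (c := ∏ i : Fin t.length, ∑' n : ℤ, ‖wz z n (t.get i)‖)
      (fun f => norm_nonneg _) ?_
    intro u
    classical
    calc ∑ f ∈ u, ‖∏ i, wz z (f i) (t.get i)‖
        ≤ ∑ f ∈ Fintype.piFinset (fun i => u.image (fun f => f i)),
            ‖∏ i, wz z (f i) (t.get i)‖ := by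
          refine Finset.sum_le_sum_of_subset_of_nonneg ?_ (fun _ _ _ => norm_nonneg _)
          intro f hf
          rw [Fintype.mem_piFinset]
          exact fun i => Finset.mem_image_of_mem _ hf
      _ = ∏ i : Fin t.length, ∑ n ∈ u.image (fun f => f i), ‖wz z n (t.get i)‖ := by
          rw [Finset.prod_univ_sum]
          simp only [norm_prod]
      _ ≤ _ := by
          refine Finset.prod_le_prod (fun i _ => Finset.sum_nonneg fun _ _ => norm_nonneg _) ?_
          intro i _
          exact (summable_wz z _ (ht _ (List.get_mem _ _))).sum_le_tsum _
            (fun _ _ => norm_nonneg _)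
  exact this.subtype _

open Filter Topology in
theorem tendsto_TN (z : ℂ) (t : List ℕ) (ht : ∀ x ∈ t, 2 ≤ x) :
    Tendsto (fun N : ℕ => TN z (-N) (2 * N + 1) t) atTop (𝓝 (Te t z)) := by
  classical
  have h := (summable_Te z t ht).hasSum
  have h2 : Tendsto (fun N : ℕ => (AF (-N) (2 * N + 1) t.length).subtype StrictAnti)
      atTop atTop := by
    refine Filter.tendsto_atTop_finset_of_monotone ?_ ?_
    · intro N N' hN f hf
      rw [Finset.mem_subtype, mem_AF] at hf ⊢
      refine ⟨hf.1, fun i => ?_⟩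
      have := hf.2 i
      push_cast at this ⊢; omega
    · intro f
      refine ⟨∑ i, (f.1 i).natAbs, ?_⟩
      rw [Finset.mem_subtype, mem_AF]
      refine ⟨f.2, fun i => ?_⟩
      have := Finset.single_le_sum (f := fun i => (f.1 i).natAbs) (fun _ _ => Nat.zero_le _)
        (Finset.mem_univ i)
      zify at this ⊢
      have h3 := abs_le.1 this
      omega
  have h3 := Tendsto.comp h h2
  refine Tendsto.congr ?_ h3
  intro N
  rw [TN_eq]
  simp only [Function.comp]
  exact Finset.sum_subtype_of_mem (f := fun f : Fin t.length → ℤ => ∏ i, wz z (f i) (t.get i))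
    (fun f hf => ((mem_AF _ _ _ _).1 hf).1)

theorem block_ge {s : List ℕ} (hs : ∀ x ∈ s, 2 ≤ x) {l : List (List ℕ)} (hl : l ∈ decs s) :
    ∀ b ∈ l, ∀ x ∈ b, 2 ≤ x := by
  rw [mem_decs] at hl
  intro b hb x hx
  apply hs
  rw [← hl.1]
  exact List.mem_flatten.2 ⟨b, hb, hx⟩

theorem sums_ge {s : List ℕ} (hs : ∀ x ∈ s, 2 ≤ x) {l : List (List ℕ)} (hl : l ∈ decs s) :
    ∀ x ∈ l.map List.sum, 2 ≤ x := by
  intro x hx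
  obtain ⟨b, hb, rfl⟩ := List.mem_map.1 hx
  have h := block_ge hs hl b hb
  cases b with
  | nil => exact absurd hb ((mem_decs _ _).1 hl).2
  | cons a b => have := h a (by simp); simp; omega

open Filter Topology in
theorem tendsto_Tan (z : ℂ) (s : List ℕ) (hs : ∀ x ∈ s, 2 ≤ x) :
    Tendsto (fun N : ℕ => Co (lg s.length (TN z (-N) (2 * N + 1))) s) atTop (𝓝 (Tan s z)) := by
  rw [Tan_eq]
  refine tendsto_list_sum _ fun l hl => ?_
  refine Tendsto.const_mul _ ?_
  rw [Ten_eq]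
  have hlen : (l.map List.sum).length ≤ s.length := by
    rw [mem_decs] at hl
    have := len_le_flatten l hl.2
    rw [hl.1] at this
    simpa using this
  simp only [← decs_lg _ (TN_nil z _ _) _ _ hlen]
  refine tendsto_list_sum _ fun l' hl' => ?_
  refine Tendsto.const_mul _ ?_
  refine tendsto_list_prod _ fun b hb => ?_
  exact tendsto_TN z b (block_ge (sums_ge hs hl) hl' b hb)

theorem sign_eq (s : List ℕ) (hs : ∀ x ∈ s, 2 ≤ x) :
    s.sum = (s.map (fun x => x - 1)).sum + s.length := by
  induction s with
  | nil => simp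
  | cons a t ih =>
    have h1 := ih (fun x hx => hs x (by simp [hx]))
    have h2 := hs a (by simp)
    simp only [List.sum_cons, List.map_cons, List.length_cons]; omega
end Mould
end

/-- Parity separation of alternal multitangents: with `dᵢ := sᵢ − 1`,
`Tan^{s₁,…,s_r}(−z) = (−1)^{1 + d₁ + ⋯ + d_r} · Tan^{s₁,…,s_r}(z)`; i.e. `Tan^{s₁,…,s_r}` is
even when `d₁+⋯+d_r` is odd, and odd when `d₁+⋯+d_r` is even. -/
theorem Tan_parity_separation
    (s : List ℕ) (hr : 1 ≤ s.length) (hs : ∀ x ∈ s, 2 ≤ x)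
    (z : ℂ) (hz : ∀ n : ℤ, z ≠ (n : ℂ)) :
    Tan s (-z) = (-1 : ℂ) ^ (1 + (s.map (fun x => x - 1)).sum) * Tan s z := by
  have h1 := (Mould.tendsto_Tan (-z) s hs).const_mul ((-1 : ℂ) ^ (s.sum + s.length))
  have h2 := (Mould.tendsto_Tan z s hs).neg
  have h3 := tendsto_nhds_unique (h1.congr fun N =>
    Mould.trunc_parity z N s.length s le_rfl) h2
  rw [Mould.sign_eq s hs] at h3
  generalize (s.map (fun x => x - 1)).sum = d at h3 ⊢
  have e1 : (-1 : ℂ) ^ d * (-1 : ℂ) ^ d = 1 := by rw [← mul_pow]; simp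
  have e2 : (-1 : ℂ) ^ s.length * (-1 : ℂ) ^ s.length = 1 := by rw [← mul_pow]; simp
  rw [pow_add, pow_add, mul_assoc ((-1 : ℂ) ^ d), e2, mul_one] at h3
  rw [pow_add, pow_one]
  linear_combination (-1 : ℂ) ^ d * h3 - Tan s (-z) * e1
end

section
/- Alternality of Tan: let s′ and s″ be nonempty finite sequences of integers all ≥ 2. Then for every z ∈ ℂ ∖ ℤ, ∑_{w ∈ sha(s′,s″)} Tan^{w}(z) = 0, the sum (with multiplicity) running over the multiset sha(s′,s″) of plain shuffles of s′ and s″. -/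
/-- The multiset of plain shuffles of two sequences: all interleavings preserving the internal
order of each sequence. -/
def sha : List ℕ → List ℕ → Multiset (List ℕ)
  | [], t => {t}
  | a :: s, [] => {a :: s}
  | a :: s, b :: t =>
      ((sha s (b :: t)).map (a :: ·)) + ((sha (a :: s) t).map (b :: ·))
termination_by s t => s.length + t.length


namespace TanAux

def dec {R : Type*} [AddCommMonoid R] : List ℕ → (List ℕ → List ℕ → R) → R
  | [], f => f [] []
  | a :: s, f => f [] (a :: s) + dec s (fun p q => f (a :: p) q)

def exB (a : ℕ) : List (List ℕ) → List (List (List ℕ))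
  | [] => [[[a]]]
  | b :: B => [[a] :: b :: B, (a :: b) :: B]

def Bl : List ℕ → List (List (List ℕ))
  | [] => [[]]
  | a :: s => (Bl s).flatMap (exB a)

def K {R : Type*} [AddCommMonoid R] (s : List ℕ) (F : List (List ℕ) → R) : R :=
  ((Bl s).map F).sum

def TL : List ℂ → List ℕ → ℂ
  | _, [] => 1
  | [], _ :: _ => 0
  | x :: L, a :: t => TL L (a :: t) + x ^ a * TL L t

theorem TL_nil (L : List ℂ) : TL L [] = 1 := by cases L <;> rfl

section
variable {R : Type*} [AddCommMonoid R]

theorem dec_add (s : List ℕ) (f g : List ℕ → List ℕ → R) :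
    dec s (fun p q => f p q + g p q) = dec s f + dec s g := by
  induction s generalizing f g with
  | nil => rfl
  | cons a s ih => simp only [dec, ih]; abel

theorem dec_zero (s : List ℕ) : dec s (fun _ _ => (0 : R)) = 0 := by
  induction s with
  | nil => rfl
  | cons a s ih => simp only [dec, ih]; simp

theorem dec_mul {R : Type*} [CommSemiring R] (c : R) (s : List ℕ) (f : List ℕ → List ℕ → R) :
    dec s (fun p q => c * f p q) = c * dec s f := by
  induction s generalizing f with
  | nil => rfl
  | cons a s ih => simp only [dec, ih]; ring

theorem K_add (s : List ℕ) (F G : List (List ℕ) → R) :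
    K s (fun B => F B + G B) = K s F + K s G := by
  simp only [K, List.sum_map_add]

theorem K_mul {R : Type*} [CommSemiring R] (c : R) (s : List ℕ) (F : List (List ℕ) → R) :
    K s (fun B => c * F B) = c * K s F := by
  simp only [K, List.sum_map_mul_left]

theorem K_nil (F : List (List ℕ) → R) : K [] F = F [] := by simp [K, Bl]

theorem sum_flatMap' {α β : Type*} (l : List α) (g : α → List β) (F : β → R) :
    ((l.flatMap g).map F).sum = (l.map (fun x => ((g x).map F).sum)).sum := by
  induction l with
  | nil => simp
  | cons a l ih => simp [List.flatMap_cons, ih]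

theorem Bl_mem (s : List ℕ) (B : List (List ℕ)) :
    B ∈ Bl s ↔ B.flatten = s ∧ [] ∉ B := by
  induction s generalizing B with
  | nil =>
    simp only [Bl, List.mem_singleton]
    constructor
    · rintro rfl; simp
    · rintro ⟨h1, h2⟩
      cases B with
      | nil => rfl
      | cons b B =>
        simp at h1 h2
        exact absurd h1.1.symm (fun h => h2.1 h.symm)
  | cons a s ih =>
    simp only [Bl, List.mem_flatMap, ih]
    constructor
    · rintro ⟨C, ⟨rfl, h2⟩, h3⟩
      cases C with
      | nil => simp [exB] at h3; subst h3; simp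
      | cons c C =>
        simp [exB] at h3
        simp at h2
        rcases h3 with rfl | rfl <;> simp [h2]
    · rintro ⟨h1, h2⟩
      rcases B with _ | ⟨b, B⟩
      · simp at h1
      rcases b with _ | ⟨x, b⟩
      · simp at h2
      simp at h1 h2
      obtain ⟨rfl, h1⟩ := h1
      rcases b with _ | ⟨y, b⟩
      · refine ⟨B, ⟨by simpa using h1, h2⟩, ?_⟩
        cases B <;> simp [exB]
      · exact ⟨(y :: b) :: B, ⟨by simpa using h1, by simpa using h2⟩, by simp [exB]⟩

theorem Bl_nodup (s : List ℕ) : (Bl s).Nodup := by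
  induction s with
  | nil => simp [Bl]
  | cons a s ih =>
    rw [Bl, List.nodup_flatMap]
    constructor
    · intro B hB
      rcases B with _ | ⟨b, B⟩
      · simp [exB]
      · simp [exB]
    · refine List.Pairwise.imp_of_mem ?_ ih
      intro B C hB hC hne
      rw [Bl_mem] at hB hC
      intro D h1 h2
      rcases B with _ | ⟨b, B⟩ <;> rcases C with _ | ⟨c, C⟩ <;> simp [exB] at h1 h2 hne hB hC
      · subst h1; grind
      · subst h2; grind
      · grind

theorem K_exB (a b : ℕ) (s : List ℕ) (F : List (List ℕ) → R) :
    K (a :: b :: s) F = K (b :: s) (fun B => F ([a] :: B) +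
      F (match B with | [] => [[a]] | c :: C => (a :: c) :: C)) := by
  unfold K
  rw [Bl, sum_flatMap']
  congr 1
  apply List.map_congr_left
  intro B hB
  rw [Bl_mem] at hB
  rcases B with _ | ⟨c, C⟩
  · simp at hB
  · simp [exB]

theorem K_cons (a : ℕ) (s : List ℕ) (F : List (List ℕ) → R) :
    K (a :: s) F = dec s (fun p q => K q (fun B => F ((a :: p) :: B))) := by
  induction s generalizing a F with
  | nil => simp [K, Bl, exB, dec]
  | cons b s ih =>
    rw [K_exB, K_add, dec, ih b (fun B => F (match B with | [] => [[a]] | c :: C => (a :: c) :: C))]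

theorem K_comp (s : List ℕ) (F : List (List ℕ) → R) :
    ∑ c : Composition s.length, F (s.splitWrtComposition c) = K s F := by
  have : (Finset.univ : Finset (Composition s.length)).val.map
      (fun c => s.splitWrtComposition c) = (Bl s : Multiset (List (List ℕ))) := by
    refine Multiset.Nodup.ext ?_ ?_ |>.2 ?_
    · refine Multiset.Nodup.map ?_ (Finset.nodup _)
      intro c d h
      simp only at h
      have h1 := List.map_length_splitWrtComposition s c
      have h2 := List.map_length_splitWrtComposition s d
      rw [h] at h1
      exact Composition.ext (h1.symm.trans h2)
    · exact Bl_nodup s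
    · intro B
      simp only [Multiset.mem_map, Multiset.mem_coe, Bl_mem]
      constructor
      · rintro ⟨c, -, rfl⟩
        refine ⟨List.flatten_splitWrtComposition s c, ?_⟩
        intro h
        have := List.length_pos_of_mem_splitWrtComposition h
        simp at this
      · rintro ⟨rfl, h⟩
        refine ⟨⟨B.map List.length, ?_, ?_⟩, Finset.mem_univ_val _, ?_⟩
        · intro i hi
          simp only [List.mem_map] at hi
          obtain ⟨b, hb, rfl⟩ := hi
          exact List.length_pos_iff.2 (by rintro rfl; exact h hb)
        · simp [List.length_flatten]
        · exact List.splitWrtComposition_flatten B _ rfl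
  unfold K
  rw [Finset.sum_eq_multiset_sum]
  have h2 := congrArg (fun m => (m.map F).sum) this
  simpa [Multiset.map_map, Function.comp_def] using h2

def Sh (u v : List ℕ) (f : List ℕ → R) : R := ((sha u v).map f).sum

theorem Sh_nil_left (v : List ℕ) (f : List ℕ → R) : Sh [] v f = f v := by simp [Sh, sha]
theorem Sh_nil_right (u : List ℕ) (f : List ℕ → R) : Sh u [] f = f u := by
  cases u <;> simp [Sh, sha]
theorem Sh_cons (a b : ℕ) (u v : List ℕ) (f : List ℕ → R) :
    Sh (a :: u) (b :: v) f = Sh u (b :: v) (fun w => f (a :: w)) +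
      Sh (a :: u) v (fun w => f (b :: w)) := by
  simp [Sh, sha, Multiset.map_map, Function.comp_def]
theorem Sh_add (u v : List ℕ) (f g : List ℕ → R) :
    Sh u v (fun w => f w + g w) = Sh u v f + Sh u v g := by
  simp [Sh]
theorem Sh_mul {R : Type*} [CommSemiring R] (c : R) (u v : List ℕ) (f : List ℕ → R) :
    Sh u v (fun w => c * f w) = c * Sh u v f := by
  simp [Sh, Multiset.sum_map_mul_left]

theorem Sh_dec (u v : List ℕ) (f : List ℕ → List ℕ → R) :
    Sh u v (fun w => dec w f) = dec u (fun u1 u2 => dec v (fun v1 v2 =>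
      Sh u1 v1 (fun p => Sh u2 v2 (fun q => f p q)))) := by
  induction u generalizing v f with
  | nil => simp [Sh_nil_left, dec]
  | cons a u ihu =>
    induction v generalizing f with
    | nil => simp only [Sh_nil_right, dec]
    | cons b v ihv =>
      rw [Sh_cons]
      conv_lhs => simp only [dec]
      rw [Sh_add, Sh_add, ihu, ihv]
      conv_rhs => simp only [dec, Sh_nil_left, Sh_nil_right, Sh_cons, dec_add]
      conv_lhs => simp only [dec, Sh_nil_left, Sh_nil_right, dec_add]
      abel

end

theorem TL_append (L₁ L₂ : List ℂ) (t : List ℕ) :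
    TL (L₁ ++ L₂) t = dec t (fun u v => TL L₁ u * TL L₂ v) := by
  induction L₁ generalizing t with
  | nil =>
    cases t with
    | nil => simp [dec, TL_nil]
    | cons a t => simp [dec, TL, dec_zero]
  | cons x L ih =>
    cases t with
    | nil => simp [dec, TL_nil]
    | cons a t =>
      simp only [List.cons_append, TL, dec, ih, add_mul, dec_add, mul_assoc, dec_mul, TL_nil]
      ring

noncomputable def ph (B : List (List ℕ)) : ℂ :=
  (B.map (fun b => (1 : ℂ) / (b.length.factorial : ℂ))).prod

noncomputable def EL (L : List ℂ) (s : List ℕ) : ℂ :=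
  K s (fun B => ph B * TL L (B.map List.sum))

theorem EL_nil (L : List ℂ) : EL L [] = 1 := by simp [EL, K_nil, ph, TL_nil]
theorem EL_nil_cons (a : ℕ) (s : List ℕ) : EL [] (a :: s) = 0 := by
  rw [EL, K_cons]
  simp [TL, dec_zero, K]

theorem EL_cons (x : ℂ) (L : List ℂ) (s : List ℕ) :
    EL (x :: L) s = dec s (fun u v => x ^ u.sum * (1 / (u.length.factorial : ℂ)) * EL L v) := by
  cases s with
  | nil => simp [dec, EL_nil]
  | cons a s =>
    have h : EL L (a :: s) = dec s (fun p q => K q (fun B => ph ((a :: p) :: B) *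
        TL L ((a :: p).sum :: B.map List.sum))) := by
      simp [EL, K_cons]
    rw [dec, h, EL, K_cons]
    simp only [List.map_cons, TL, mul_add, K_add, dec_add]
    simp only [List.sum_nil, List.length_nil, pow_zero, Nat.factorial_zero, Nat.cast_one, div_one,
      one_mul]
    congr 2
    funext p q
    rw [EL, ← K_mul]
    congr 1
    funext B
    simp only [ph, List.map_cons, List.prod_cons]
    ring

theorem Sh_fac (x : ℂ) (u v : List ℕ) (g : ℕ → ℂ) :
    Sh u v (fun w => x ^ w.sum * g w.length) =
      ((u.length + v.length).choose u.length : ℂ) *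
        (x ^ u.sum * x ^ v.sum * g (u.length + v.length)) := by
  induction u generalizing v g with
  | nil => simp [Sh_nil_left]
  | cons a u ihu =>
    induction v generalizing g with
    | nil => simp [Sh_nil_right]
    | cons b v ihv =>
      rw [Sh_cons]
      simp only [List.sum_cons, List.length_cons, pow_add, mul_assoc, Sh_mul]
      have h1 := ihu (b :: v) (fun n => g (n + 1))
      have h2 := ihv (fun n => g (n + 1))
      simp only [List.sum_cons, List.length_cons, pow_add] at h1 h2
      rw [h1, h2]
      have e1 : u.length + 1 + v.length + 1 = u.length + 1 + (v.length + 1) := by ring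
      have e2 : u.length + (v.length + 1) + 1 = u.length + 1 + (v.length + 1) := by ring
      have e3 : u.length + 1 + v.length = u.length + (v.length + 1) := by ring
      have e4 : (u.length + 1 + (v.length + 1)).choose (u.length + 1) =
        (u.length + (v.length + 1)).choose u.length +
        (u.length + (v.length + 1)).choose (u.length + 1) := by
        rw [← e2, Nat.choose_succ_succ]
      rw [e1, e2, e3, e4]
      push_cast
      ring

theorem Sh_exp (x : ℂ) (u v : List ℕ) :
    Sh u v (fun w => x ^ w.sum * (1 / (w.length.factorial : ℂ))) =
      (x ^ u.sum * (1 / (u.length.factorial : ℂ))) *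
      (x ^ v.sum * (1 / (v.length.factorial : ℂ))) := by
  rw [Sh_fac x u v (fun n => 1 / (n.factorial : ℂ))]
  have h := Nat.add_choose_mul_factorial_mul_factorial v.length u.length
  rw [add_comm v.length, mul_right_comm] at h
  have h' : (((u.length + v.length).choose u.length : ℂ)) * u.length.factorial *
    v.length.factorial = (u.length + v.length).factorial := by exact_mod_cast h
  have a1 : (u.length.factorial : ℂ) ≠ 0 := by exact_mod_cast Nat.factorial_ne_zero _
  have a2 : (v.length.factorial : ℂ) ≠ 0 := by exact_mod_cast Nat.factorial_ne_zero _
  have a3 : ((u.length + v.length).factorial : ℂ) ≠ 0 := by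
    exact_mod_cast Nat.factorial_ne_zero _
  field_simp
  linear_combination (x ^ u.sum * x ^ v.sum) * h'

theorem EL_sh (L : List ℂ) (u v : List ℕ) : Sh u v (EL L) = EL L u * EL L v := by
  induction L generalizing u v with
  | nil =>
    cases u with
    | nil => simp [Sh_nil_left, EL_nil]
    | cons a u =>
      cases v with
      | nil => simp [Sh_nil_right, EL_nil]
      | cons b v => rw [Sh_cons]; simp [EL_nil_cons, Sh]
  | cons x L ih =>
    have : EL (x :: L) = fun s =>
      dec s (fun u v => x ^ u.sum * (1 / (u.length.factorial : ℂ)) * EL L v) :=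
      funext (EL_cons x L)
    rw [this, Sh_dec]
    simp only [Sh_mul, ih]
    have e : ∀ u1 u2 v1 v2 : List ℕ, Sh u1 v1 (fun p => x ^ p.sum *
        (1 / (p.length.factorial : ℂ)) * (EL L u2 * EL L v2)) =
        (x ^ u1.sum * (1 / (u1.length.factorial : ℂ)) * EL L u2) *
          (x ^ v1.sum * (1 / (v1.length.factorial : ℂ)) * EL L v2) := by
      intro u1 u2 v1 v2
      have := Sh_mul (EL L u2 * EL L v2) u1 v1
        (fun w => x ^ w.sum * (1 / (w.length.factorial : ℂ)))
      rw [Sh_exp] at this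
      simp only [mul_comm (_ * _) (EL L u2 * EL L v2)]
      rw [this]; ring
    simp only [e, dec_mul]
    rw [mul_comm (dec u _), ← dec_mul]
    congr 1
    funext p q
    ring

end TanAux

namespace TanAux

open Polynomial in
noncomputable def chP (k : ℕ) : ℂ[X] := C (1 / (k.factorial : ℂ)) * descPochhammer ℂ k

theorem chP_eval (k m : ℕ) : (chP k).eval (m : ℂ) = (m.choose k : ℂ) := by
  have a1 : (k.factorial : ℂ) ≠ 0 := by exact_mod_cast Nat.factorial_ne_zero _
  rw [chP, Polynomial.eval_mul, Polynomial.eval_C, descPochhammer_eval_eq_descFactorial,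
    Nat.descFactorial_eq_factorial_mul_choose]
  push_cast
  field_simp

theorem dp_neg_one (n : ℕ) : (descPochhammer ℂ n).eval (-1) = (-1) ^ n * (n.factorial : ℂ) := by
  induction n with
  | zero => simp
  | succ n ih =>
    rw [descPochhammer_succ_eval, ih, Nat.factorial_succ]; push_cast; ring

theorem chP_coeff (k : ℕ) : (chP k).coeff 1 = (-1 : ℂ) ^ (k - 1) / (k : ℂ) := by
  cases k with
  | zero => simp [chP, Polynomial.coeff_one]
  | succ n =>
    have a1 : (n.factorial : ℂ) ≠ 0 := by exact_mod_cast Nat.factorial_ne_zero _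
    have a2 : (n : ℂ) + 1 ≠ 0 := by exact_mod_cast Nat.succ_ne_zero n
    rw [chP, Polynomial.coeff_C_mul, descPochhammer_succ_left, Polynomial.coeff_X_mul,
      Polynomial.coeff_zero_eq_eval_zero, Polynomial.eval_comp]
    simp only [Polynomial.eval_sub, Polynomial.eval_X, Polynomial.eval_one, zero_sub, dp_neg_one,
      Nat.factorial_succ]
    push_cast
    field_simp

theorem K_map {R S : Type*} [AddCommMonoid R] [AddCommMonoid S] (φ : R →+ S) (s : List ℕ)
    (F : List (List ℕ) → R) : φ (K s F) = K s (fun B => φ (F B)) := by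
  simp [K, map_list_sum, Function.comp_def]

noncomputable def pr (f : List ℕ → ℂ) (B : List (List ℕ)) : ℂ := (B.map f).prod

open Polynomial in
noncomputable def PL (L : List ℂ) (t : List ℕ) : ℂ[X] :=
  K t (fun B => C (pr (TL L) B) * chP B.length)

def rep (L : List ℂ) : ℕ → List ℂ
  | 0 => []
  | m + 1 => L ++ rep L m

theorem K_zero {R : Type*} [AddCommMonoid R] (s : List ℕ) : K s (fun _ => (0 : R)) = 0 := by
  simp [K]

theorem K_choose (L : List ℂ) (m : ℕ) (t : List ℕ) :
    K t (fun B => pr (TL L) B * (m.choose B.length : ℂ)) = TL (rep L m) t := by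
  induction m generalizing t with
  | zero =>
    cases t with
    | nil => simp [K_nil, pr, TL_nil]
    | cons a t => rw [K_cons]; simp [K_zero, dec_zero, rep, TL]
  | succ m ih =>
    rw [rep, TL_append]
    cases t with
    | nil => simp [K_nil, pr, TL_nil, dec]
    | cons a t =>
      rw [dec, ← ih, K_cons, K_cons, TL_nil, one_mul, ← dec_add]
      congr 1
      funext p q
      rw [← ih, ← K_mul, ← K_add]
      congr 1
      funext B
      simp only [List.length_cons, Nat.choose_succ_succ, pr, List.map_cons, List.prod_cons]
      push_cast
      ring

theorem PL_eval (L : List ℂ) (m : ℕ) (t : List ℕ) :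
    (PL L t).eval (m : ℂ) = TL (rep L m) t := by
  rw [← K_choose]
  have := K_map (Polynomial.evalRingHom (m : ℂ)).toAddMonoidHom t
    (fun B => Polynomial.C (pr (TL L) B) * chP B.length)
  simpa [PL, chP_eval] using this

/-- truncated versions, for an arbitrary mould -/
noncomputable def TenM (f : List ℕ → ℂ) (t : List ℕ) : ℂ :=
  K t (fun B => (-1 : ℂ) ^ (B.length - 1) / (B.length : ℂ) * pr f B)

noncomputable def TanM (f : List ℕ → ℂ) (s : List ℕ) : ℂ :=
  K s (fun B => ph B * TenM f (B.map List.sum))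

theorem PL_coeff (L : List ℂ) (t : List ℕ) : (PL L t).coeff 1 = TenM (TL L) t := by
  have := K_map (Polynomial.lcoeff ℂ 1).toAddMonoidHom t
    (fun B => Polynomial.C (pr (TL L) B) * chP B.length)
  simp only [LinearMap.toAddMonoidHom_coe, Polynomial.lcoeff_apply, Polynomial.coeff_C_mul,
    chP_coeff] at this
  rw [PL, this, TenM]
  congr 1
  funext B
  ring

open Polynomial in
noncomputable def QL (L : List ℂ) (s : List ℕ) : ℂ[X] :=
  K s (fun B => C (ph B) * PL L (B.map List.sum))

theorem QL_eval (L : List ℂ) (m : ℕ) (s : List ℕ) :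
    (QL L s).eval (m : ℂ) = EL (rep L m) s := by
  have := K_map (Polynomial.evalRingHom (m : ℂ)).toAddMonoidHom s
    (fun B => Polynomial.C (ph B) * PL L (B.map List.sum))
  simpa [QL, PL_eval, EL] using this

theorem QL_coeff (L : List ℂ) (s : List ℕ) : (QL L s).coeff 1 = TanM (TL L) s := by
  have := K_map (Polynomial.lcoeff ℂ 1).toAddMonoidHom s
    (fun B => Polynomial.C (ph B) * PL L (B.map List.sum))
  simpa [QL, PL_coeff, TanM] using this

theorem Sh_map {R S : Type*} [AddCommMonoid R] [AddCommMonoid S] (φ : R →+ S) (u v : List ℕ)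
    (F : List ℕ → R) : φ (Sh u v F) = Sh u v (fun B => φ (F B)) := by
  simp [Sh, map_multiset_sum, Function.comp_def]

theorem QL_sh (L : List ℂ) (u v : List ℕ) : Sh u v (QL L) = QL L u * QL L v := by
  apply Polynomial.eq_of_infinite_eval_eq
  refine Set.Infinite.mono ?_ (Set.infinite_range_of_injective (Nat.cast_injective (R := ℂ)))
  rintro _ ⟨m, rfl⟩
  have := Sh_map (Polynomial.evalRingHom (m : ℂ)).toAddMonoidHom u v (QL L)
  have h2 := EL_sh (rep L m) u v
  simp only [Set.mem_ofPred_eq, Polynomial.eval_mul, QL_eval, ← h2]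
  simpa [QL_eval] using this

theorem QL_zero (L : List ℂ) (u : List ℕ) (hu : u ≠ []) : (QL L u).coeff 0 = 0 := by
  rw [Polynomial.coeff_zero_eq_eval_zero]
  have := QL_eval L 0 u
  rw [Nat.cast_zero] at this
  rw [this]
  cases u with
  | nil => exact absurd rfl hu
  | cons a u => exact EL_nil_cons a u

theorem TanM_sh (L : List ℂ) (u v : List ℕ) (hu : u ≠ []) (hv : v ≠ []) :
    Sh u v (TanM (TL L)) = 0 := by
  have := Sh_map (Polynomial.lcoeff ℂ 1).toAddMonoidHom u v (QL L)
  simp only [LinearMap.toAddMonoidHom_coe, Polynomial.lcoeff_apply, QL_coeff, QL_sh] at this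
  change _ = Sh u v (TanM (TL L)) at this
  rw [← this, Polynomial.coeff_mul]
  simp [Finset.antidiagonal, Finset.Nat.antidiagonal_succ, QL_zero, hu, hv]

theorem Tan_eq (s : List ℕ) (z : ℂ) : Tan s z = TanM (fun t => Te t z) s := by
  have hT : ∀ t, Ten t z = TenM (fun t => Te t z) t := by
    intro t
    rw [TenM, ← K_comp, Ten]
    simp only [pr, List.length_splitWrtComposition]
  rw [TanM, ← K_comp, Tan]
  simp only [hT, ph]

open Filter Topology

theorem K_tendsto (s : List ℕ) (F : ℕ → List (List ℕ) → ℂ) (G : List (List ℕ) → ℂ)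
    (h : ∀ B ∈ Bl s, Tendsto (fun N => F N B) atTop (𝓝 (G B))) :
    Tendsto (fun N => K s (F N)) atTop (𝓝 (K s G)) :=
  tendsto_list_sum (f := fun B N => F N B) (a := G) _ h

theorem TanM_tendsto (f : ℕ → List ℕ → ℂ) (g : List ℕ → ℂ)
    (hfg : ∀ t : List ℕ, (∀ x ∈ t, 2 ≤ x) → Tendsto (fun N => f N t) atTop (𝓝 (g t)))
    (s : List ℕ) (hs : ∀ x ∈ s, 2 ≤ x) :
    Tendsto (fun N => TanM (f N) s) atTop (𝓝 (TanM g s)) := by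
  have key : ∀ (s : List ℕ), (∀ x ∈ s, 2 ≤ x) → ∀ B ∈ Bl s, ∀ b ∈ B, ∀ x ∈ b, 2 ≤ x := by
    intro s hs B hB b hb x hx
    rw [Bl_mem] at hB
    apply hs
    rw [← hB.1]
    exact List.mem_flatten.2 ⟨b, hb, hx⟩
  refine K_tendsto s _ _ fun B hB => Tendsto.const_mul _ ?_
  refine K_tendsto _ _ _ fun D hD => Tendsto.const_mul _ ?_
  refine tendsto_list_prod (f := fun b N => f N b) (a := g) _ fun b hb => hfg b ?_
  refine key _ ?_ D hD b hb
  intro x hx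
  obtain ⟨c, hc, rfl⟩ := List.mem_map.1 hx
  have h1 := key s hs B hB c hc
  rw [Bl_mem] at hB
  rcases c with _ | ⟨y, c⟩
  · exact absurd hc hB.2
  · have := h1 y (by simp)
    simp; omega

/-- value of a list of integers -/
noncomputable def val (z : ℂ) (s : List ℕ) (l : List ℤ) : ℂ :=
  (List.zipWith (fun (n : ℤ) (a : ℕ) => (((n : ℂ) + z)⁻¹) ^ a) l s).prod

theorem TL_sublists (z : ℂ) (L : List ℤ) (s : List ℕ) :
    TL (L.map fun n : ℤ => ((n : ℂ) + z)⁻¹) s = ((L.sublistsLen s.length).map (val z s)).sum := by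
  induction L generalizing s with
  | nil => cases s <;> simp [TL, val]
  | cons x L ih =>
    cases s with
    | nil => simp [TL, val]
    | cons a s =>
      simp only [List.map_cons, TL, ih, List.length_cons, List.sublistsLen_succ_cons,
        List.map_append, List.sum_append, List.map_map, ← List.sum_map_mul_left]
      simp [val, Function.comp_def]

theorem val_ofFn (z : ℂ) (s : List ℕ) (n : Fin s.length → ℤ) :
    ∏ i : Fin s.length, ((n i : ℂ) + z) ^ (-(s.get i : ℤ)) = val z s (List.ofFn n) := by
  induction s with
  | nil => simp [val]
  | cons a s ih =>
    have := ih (fun i => n i.succ)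
    simp only [List.length_cons, Fin.prod_univ_succ, List.ofFn_succ, val, List.zipWith_cons_cons,
      List.prod_cons]
    rw [val] at this
    rw [← this]
    simp

theorem summable_aux (z : ℂ) (s : List ℕ) (hs : ∀ x ∈ s, 2 ≤ x) :
    Summable (fun n : Fin s.length → ℤ => ∏ i, ((n i : ℂ) + z) ^ (-(s.get i : ℤ))) := by
  classical
  apply Summable.of_norm
  have h1 : ∀ i : Fin s.length, Summable (fun n : ℤ => ‖((n : ℂ) + z) ^ (-(s.get i : ℤ))‖) := by
    intro i
    have h := EisensteinSeries.linear_right_summable z 1 (k := (s.get i : ℤ))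
      (by exact_mod_cast hs _ (List.get_mem s i))
    refine h.norm.congr ?_
    intro n
    rw [zpow_neg]
    simp [add_comm]
  refine summable_of_sum_le
    (c := ∏ i : Fin s.length, ∑' n : ℤ, ‖((n : ℂ) + z) ^ (-(s.get i : ℤ))‖)
    (fun _ => norm_nonneg _) ?_
  intro u
  calc ∑ n ∈ u, ‖∏ i, ((n i : ℂ) + z) ^ (-(s.get i : ℤ))‖
      ≤ ∑ n ∈ (Fintype.piFinset (fun i => u.image (fun n => n i)) :
          Finset (Fin s.length → ℤ)),
          ‖∏ i, ((n i : ℂ) + z) ^ (-(s.get i : ℤ))‖ := by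
        refine Finset.sum_le_sum_of_subset_of_nonneg ?_ (fun n _ _ => norm_nonneg (_ : ℂ))
        intro n hn
        simp only [Fintype.mem_piFinset, Finset.mem_image]
        exact fun i => ⟨n, hn, rfl⟩
    _ = ∏ i : Fin s.length, ∑ k ∈ Finset.image (fun n : Fin s.length → ℤ => (n i : ℤ)) u,
         ‖(((k : ℤ) : ℂ) + z) ^ (-(s.get i : ℤ))‖ := by
        simp only [norm_prod]
        rw [Finset.prod_univ_sum]
    _ ≤ _ := by
        refine Finset.prod_le_prod (fun _ _ => Finset.sum_nonneg fun k _ =>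
          norm_nonneg (_ : ℂ)) ?_
        intro i _
        exact (h1 i).sum_le_tsum _ (fun _ _ => norm_nonneg _)

noncomputable def LN (N : ℕ) : List ℤ := (Finset.Icc (-(N : ℤ)) N).sort (· ≥ ·)

theorem mem_sub (N : ℕ) (r : ℕ) (l : List ℤ) :
    l ∈ (LN N).sublistsLen r ↔ l.SortedGT ∧ (∀ x ∈ l, |x| ≤ N) ∧ l.length = r := by
  rw [List.mem_sublistsLen, ← and_assoc]
  refine and_congr_left fun _ => ?_
  have hL : (LN N).SortedGT := Finset.sortedGT_sort _
  constructor
  · intro h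
    refine ⟨(hL.pairwise.sublist h).sortedGT, fun x hx => ?_⟩
    have := h.subset hx
    simp only [LN, Finset.mem_sort, Finset.mem_Icc] at this
    exact abs_le.2 this
  · rintro ⟨h1, h2⟩
    refine List.sublist_of_subperm_of_sortedGE ?_ h1.sortedGE hL.sortedGE
    refine List.subperm_of_subset h1.nodup ?_
    intro x hx
    simp only [LN, Finset.mem_sort, Finset.mem_Icc]
    exact abs_le.1 (h2 x hx)

theorem Te_tendsto (z : ℂ) (s : List ℕ) (hs : ∀ x ∈ s, 2 ≤ x) :
    Tendsto (fun N => TL ((LN N).map fun n : ℤ => ((n : ℂ) + z)⁻¹) s) atTop (𝓝 (Te s z)) := by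
  classical
  have hsum : Summable (fun n : {n : Fin s.length → ℤ // StrictAnti n} =>
      ∏ i : Fin s.length, ((n.1 i : ℂ) + z) ^ (-(s.get i : ℤ))) :=
    (summable_aux z s hs).comp_injective Subtype.val_injective
  let g : {n : Fin s.length → ℤ // StrictAnti n} → List ℤ := fun n => List.ofFn n.1
  have hg : Function.Injective g := fun a b h => Subtype.ext (List.ofFn_injective h)
  let A : ℕ → Finset {n : Fin s.length → ℤ // StrictAnti n} := fun N =>
    ((LN N).sublistsLen s.length).toFinset.preimage g hg.injOn
  have hmem : ∀ N n, n ∈ A N ↔ ∀ i, |n.1 i| ≤ N := by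
    intro N n
    simp only [A, Finset.mem_preimage, List.mem_toFinset, mem_sub, g, List.length_ofFn, and_true,
      List.forall_mem_ofFn_iff]
    exact and_iff_right n.2.sortedGT_ofFn
  have hA : Tendsto A atTop atTop := by
    refine tendsto_atTop_finset_of_monotone ?_ ?_
    · intro M N h n hn
      rw [hmem] at hn ⊢
      exact fun i => (hn i).trans (by exact_mod_cast h)
    · intro n
      refine ⟨∑ i, (n.1 i).natAbs, ?_⟩
      rw [hmem]
      intro i
      rw [Int.abs_eq_natAbs]
      exact_mod_cast Finset.single_le_sum (f := fun i => (n.1 i).natAbs) (fun _ _ => Nat.zero_le _)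
        (Finset.mem_univ i)
  have := hsum.hasSum.comp hA
  refine this.congr ?_
  intro N
  simp only [Function.comp_apply, val_ofFn]
  rw [TL_sublists]
  have h3 := Finset.sum_preimage g ((LN N).sublistsLen s.length).toFinset hg.injOn (val z s) ?_
  · rw [h3, List.sum_toFinset]
    exact List.nodup_sublistsLen _ (Finset.sort_nodup _ _)
  · intro l hl hn
    refine absurd ?_ hn
    rw [List.mem_toFinset, mem_sub] at hl
    obtain ⟨h1, -, h2⟩ := hl
    refine ⟨⟨fun i => l.get (i.cast h2.symm), ?_⟩, ?_⟩
    · intro i j hij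
      exact h1.strictAnti_get hij
    · apply List.ext_get
      · simp [g, h2]
      · intro n h1 h2
        simp [g]

theorem sha_mem (u v w : List ℕ) (h : w ∈ sha u v) : ∀ x ∈ w, x ∈ u ∨ x ∈ v := by
  induction u generalizing v w with
  | nil => simp [sha] at h; subst h; simp
  | cons a u ihu =>
    induction v generalizing w with
    | nil => simp [sha] at h; subst h; simp
    | cons b v ihv =>
      simp only [sha, Multiset.mem_add, Multiset.mem_map] at h
      rcases h with ⟨w, h, rfl⟩ | ⟨w, h, rfl⟩
      · have := ihu _ _ h
        grind
      · have := ihv _ h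
        grind

end TanAux

/-- Alternality of `Tan`: the sum of `Tan` over all plain shuffles of two nonempty sequences
vanishes. -/
theorem Tan_alternal
    (s' s'' : List ℕ) (h' : s' ≠ []) (h'' : s'' ≠ [])
    (hs' : ∀ x ∈ s', 2 ≤ x) (hs'' : ∀ x ∈ s'', 2 ≤ x)
    (z : ℂ) (hz : ∀ n : ℤ, z ≠ (n : ℂ)) :
    ((sha s' s'').map (fun w => Tan w z)).sum = 0 := by
  have h1 : ∀ N : ℕ, ((sha s' s'').map
      (TanAux.TanM (TanAux.TL ((TanAux.LN N).map fun n : ℤ => ((n : ℂ) + z)⁻¹)))).sum = 0 :=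
    fun N => TanAux.TanM_sh _ s' s'' h' h''
  have h2 : Filter.Tendsto (fun N : ℕ => ((sha s' s'').map
      (TanAux.TanM (TanAux.TL ((TanAux.LN N).map fun n : ℤ => ((n : ℂ) + z)⁻¹)))).sum)
      Filter.atTop (nhds ((sha s' s'').map (fun w => Tan w z)).sum) := by
    refine tendsto_multiset_sum
      (f := fun w (N : ℕ) =>
        TanAux.TanM (TanAux.TL ((TanAux.LN N).map fun n : ℤ => ((n : ℂ) + z)⁻¹)) w)
      (a := fun w => Tan w z) _ ?_
    intro w hw
    simp only [TanAux.Tan_eq]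
    refine TanAux.TanM_tendsto _ _ (fun t ht => TanAux.Te_tendsto z t ht) w ?_
    intro x hx
    rcases TanAux.sha_mem _ _ _ hw x hx with h | h
    · exact hs' x h
    · exact hs'' x h
  simp only [h1] at h2
  exact (tendsto_nhds_unique h2 tendsto_const_nhds)
end

section
/- Existence of the direct iterator (Fatou coordinate) for a standard identity-tangent diffeomorphism: let R ≥ 2 and C > 0 with C ≤ R²/2, let H := {z ∈ ℂ : Re z > R}, and let f : ℂ → ℂ be holomorphic on H with ‖f(z) − z − 1‖ ≤ C/‖z‖² for all z ∈ H. Then (i) f maps H into H; (ii) the sequence of functions φ_k(z) := f^{∘k}(z) − k (k-fold iterate of f) converges uniformly on H to a function φ : H → ℂ; (iii) φ is holomorphic on H; (iv) φ(f(z)) = φ(z) + 1 for all z ∈ H; and (v) φ(z) − z → 0 as Re z → +∞, i.e. for every ε > 0 there is M > R such that ‖φ(z) − z‖ ≤ ε whenever Re z > M. -/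
open Filter

/-- Existence of the direct iterator (attracting Fatou coordinate) for a standard
identity-tangent diffeomorphism `f(z) = z + 1 + O(z⁻²)` on a right half-plane. -/
theorem fatou_coordinate_exists
    (R C : ℝ) (hR : 2 ≤ R) (hC : 0 < C) (hCR : C ≤ R ^ 2 / 2)
    (f : ℂ → ℂ)
    (hf : DifferentiableOn ℂ f {z : ℂ | R < z.re})
    (hbound : ∀ z ∈ {z : ℂ | R < z.re}, ‖f z - z - 1‖ ≤ C / ‖z‖ ^ 2) :
    Set.MapsTo f {z : ℂ | R < z.re} {z : ℂ | R < z.re} ∧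
    ∃ φ : ℂ → ℂ,
      TendstoUniformlyOn (fun (k : ℕ) (z : ℂ) => f^[k] z - (k : ℂ)) φ atTop
        {z : ℂ | R < z.re} ∧
      DifferentiableOn ℂ φ {z : ℂ | R < z.re} ∧
      (∀ z ∈ {z : ℂ | R < z.re}, φ (f z) = φ z + 1) ∧
      (∀ ε > 0, ∃ M : ℝ, R < M ∧ ∀ z : ℂ, R < z.re → M < z.re → ‖φ z - z‖ ≤ ε) := by
  have hRe : ∀ z : ℂ, R < z.re → z.re + 1/2 ≤ (f z).re := by
    intro z hz
    have h1 := hbound z hz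
    have h2 : R ≤ ‖z‖ := hz.le.trans (Complex.re_le_norm z)
    have h3 : C / ‖z‖ ^ 2 ≤ 1/2 := by
      rw [div_le_iff₀ (by nlinarith)]
      nlinarith
    have h4 := Complex.abs_re_le_norm (f z - z - 1)
    have h5 := (abs_le.1 (h4.trans (h1.trans h3))).1
    simp at h5
    linarith
  have hmaps : Set.MapsTo f {z : ℂ | R < z.re} {z : ℂ | R < z.re} := by
    intro z hz
    have := hRe z hz
    simp only [Set.mem_setOf_eq] at hz ⊢
    linarith
  refine ⟨hmaps, ?_⟩
  have hit : ∀ (k : ℕ) (z : ℂ), R < z.re → z.re + k / 2 ≤ (f^[k] z).re := by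
    intro k
    induction k with
    | zero => intro z hz; simp
    | succ k ih =>
      intro z hz
      rw [Function.iterate_succ_apply']
      have h1 := ih z hz
      have h0 : (0:ℝ) ≤ k := Nat.cast_nonneg k
      have h2 := hRe (f^[k] z) (by linarith)
      push_cast
      linarith
  let b : ℝ → ℕ → ℝ := fun x k => 2 * C / (x - 1/2 + k / 2)
  have hb0 : ∀ x k, R < x → 0 ≤ b x k := by
    intro x k hx
    have h0 : (0:ℝ) ≤ k := Nat.cast_nonneg k
    exact div_nonneg (by linarith) (by linarith)
  have hstep : ∀ (k : ℕ) (z : ℂ), R < z.re →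
      ‖(f^[k+1] z - ((k+1 : ℕ) : ℂ)) - (f^[k] z - (k : ℂ))‖ ≤ b z.re k - b z.re (k+1) := by
    intro k z hz
    have h1 := hit k z hz
    have h0 : (0:ℝ) ≤ k := Nat.cast_nonneg k
    have h2 := hbound (f^[k] z) (show R < _ by linarith)
    have h3 : z.re + k / 2 ≤ ‖f^[k] z‖ := h1.trans (Complex.re_le_norm _)
    have ha : 0 < z.re + k / 2 := by linarith
    have ha' : 0 < z.re - 1/2 + k / 2 := by linarith
    rw [Function.iterate_succ_apply']
    have e : (f (f^[k] z) - ((k+1 : ℕ) : ℂ)) - (f^[k] z - (k : ℂ))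
        = f (f^[k] z) - f^[k] z - 1 := by push_cast; ring
    rw [e]
    refine h2.trans ?_
    have h4 : C / ‖f^[k] z‖ ^ 2 ≤ C / (z.re + k / 2) ^ 2 := by gcongr
    refine h4.trans ?_
    have e2 : b z.re k - b z.re (k+1) = C / ((z.re - 1/2 + k / 2) * (z.re + k / 2)) := by
      simp only [b]
      have : z.re - 1/2 + ((k+1 : ℕ) : ℝ) / 2 = z.re + k / 2 := by push_cast; ring
      rw [this, div_sub_div _ _ ha'.ne' ha.ne']
      congr 1
      ring
    rw [e2]
    apply div_le_div_of_nonneg_left hC.le (by positivity)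
    nlinarith
  have hdist : ∀ (z : ℂ), R < z.re → ∀ m j : ℕ,
      ‖(f^[m+j] z - ((m+j : ℕ) : ℂ)) - (f^[m] z - (m : ℂ))‖ ≤ b z.re m - b z.re (m+j) := by
    intro z hz m j
    induction j with
    | zero => simp
    | succ j ih =>
      have h1 := hstep (m+j) z hz
      have h2 := norm_add_le ((f^[m+j+1] z - ((m+j+1 : ℕ) : ℂ)) - (f^[m+j] z - ((m+j : ℕ) : ℂ)))
        ((f^[m+j] z - ((m+j : ℕ) : ℂ)) - (f^[m] z - (m : ℂ)))
      rw [sub_add_sub_cancel] at h2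
      rw [← add_assoc]
      linarith
  have hdist' : ∀ (z : ℂ), R < z.re → ∀ m n : ℕ, m ≤ n →
      dist (f^[n] z - (n : ℂ)) (f^[m] z - (m : ℂ)) ≤ b z.re m := by
    intro z hz m n hmn
    obtain ⟨j, rfl⟩ := Nat.exists_eq_add_of_le hmn
    have h1 := hdist z hz m j
    have h2 := hb0 z.re (m+j) hz
    rw [dist_eq_norm]
    linarith
  have hbt : ∀ x, Tendsto (b x) atTop (nhds 0) := by
    intro x
    apply Tendsto.div_atTop tendsto_const_nhds
    apply tendsto_atTop_add_const_left
    exact tendsto_natCast_atTop_atTop.atTop_div_const (by norm_num)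
  have hlim : ∀ z : ℂ, ∃ w : ℂ, R < z.re →
      Tendsto (fun k : ℕ => f^[k] z - (k : ℂ)) atTop (nhds w) := by
    intro z
    by_cases hz : R < z.re
    · have hc : CauchySeq (fun k : ℕ => f^[k] z - (k : ℂ)) :=
        cauchySeq_of_le_tendsto_0' (b z.re)
          (fun m n hmn => by rw [dist_comm]; exact hdist' z hz m n hmn) (hbt z.re)
      obtain ⟨w, hw⟩ := cauchySeq_tendsto_of_complete hc
      exact ⟨w, fun _ => hw⟩
    · exact ⟨0, fun h => absurd h hz⟩
  choose φ hφ using hlim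
  have hφb : ∀ z : ℂ, R < z.re → ∀ m : ℕ, dist (φ z) (f^[m] z - (m : ℂ)) ≤ b z.re m := by
    intro z hz m
    refine le_of_tendsto ((hφ z hz).dist tendsto_const_nhds) ?_
    filter_upwards [eventually_ge_atTop m] with n hn
    exact hdist' z hz m n hn
  have hunif : TendstoUniformlyOn (fun (k : ℕ) (z : ℂ) => f^[k] z - (k : ℂ)) φ atTop
        {z : ℂ | R < z.re} := by
    rw [Metric.tendstoUniformlyOn_iff]
    intro ε hε
    filter_upwards [(hbt R).eventually (gt_mem_nhds hε)] with k hk z hz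
    have hz' : R < z.re := hz
    have h0 : (0:ℝ) ≤ k := Nat.cast_nonneg k
    refine (hφb z hz k).trans_lt (lt_of_le_of_lt ?_ hk)
    simp only [b]
    apply div_le_div_of_nonneg_left (by linarith) (by linarith)
    linarith
  have hopen : IsOpen {z : ℂ | R < z.re} := isOpen_lt continuous_const Complex.continuous_re
  refine ⟨φ, hunif, ?_, ?_, ?_⟩
  · refine hunif.tendstoLocallyUniformlyOn.differentiableOn ?_ hopen
    exact Eventually.of_forall fun k => (hf.iterate hmaps k).sub_const _
  · intro z hz
    have h1 := hφ (f z) (hmaps hz)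
    have h2 := (((tendsto_add_atTop_iff_nat 1).2 (hφ z hz)).add_const 1)
    refine tendsto_nhds_unique h1 (h2.congr fun k => ?_)
    rw [Function.iterate_succ_apply]
    push_cast
    ring
  · intro ε hε
    refine ⟨R + 2 * C / ε, by have : 0 < 2 * C / ε := by positivity
                              linarith, ?_⟩
    intro z hz hM
    have h1 := hφb z hz 0
    simp [b, dist_eq_norm] at h1
    refine h1.trans ?_
    rw [div_le_iff₀ (by linarith)]
    have h2 : 2 * C / ε ≤ z.re - 2⁻¹ := by linarith
    rw [div_le_iff₀ hε] at h2
    linarith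
end

section
/- Uniqueness of the normalized direct iterator: let R ≥ 2 and C > 0 with C ≤ R²/2, let H := {z ∈ ℂ : Re z > R}, and let f : ℂ → ℂ be holomorphic on H with ‖f(z) − z − 1‖ ≤ C/‖z‖² for all z ∈ H (so that f maps H into H). Suppose φ₁, φ₂ : H → ℂ are holomorphic on H, satisfy φ_i(f(z)) = φ_i(z) + 1 for all z ∈ H (i = 1,2), and satisfy φ_i(z) − z → 0 as Re z → +∞ (for every ε > 0 there is M > R with ‖φ_i(z) − z‖ ≤ ε whenever Re z > M). Then φ₁ = φ₂ on H. -/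
/-- Uniqueness of the normalized direct iterator (attracting Fatou coordinate): two holomorphic
solutions of the Abel equation `φ ∘ f = φ + 1` on the half-plane `{Re z > R}` that are both
normalized by `φ(z) − z → 0` as `Re z → +∞` coincide. -/
theorem fatou_coordinate_unique
    (R C : ℝ) (hR : 2 ≤ R) (hC : 0 < C) (hCR : C ≤ R ^ 2 / 2)
    (f : ℂ → ℂ)
    (hf : DifferentiableOn ℂ f {z : ℂ | R < z.re})
    (hbound : ∀ z ∈ {z : ℂ | R < z.re}, ‖f z - z - 1‖ ≤ C / ‖z‖ ^ 2)
    (φ₁ φ₂ : ℂ → ℂ)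
    (hφ₁ : DifferentiableOn ℂ φ₁ {z : ℂ | R < z.re})
    (hφ₂ : DifferentiableOn ℂ φ₂ {z : ℂ | R < z.re})
    (habel₁ : ∀ z ∈ {z : ℂ | R < z.re}, φ₁ (f z) = φ₁ z + 1)
    (habel₂ : ∀ z ∈ {z : ℂ | R < z.re}, φ₂ (f z) = φ₂ z + 1)
    (hnorm₁ : ∀ ε > 0, ∃ M : ℝ, R < M ∧ ∀ z : ℂ, R < z.re → M < z.re → ‖φ₁ z - z‖ ≤ ε)
    (hnorm₂ : ∀ ε > 0, ∃ M : ℝ, R < M ∧ ∀ z : ℂ, R < z.re → M < z.re → ‖φ₂ z - z‖ ≤ ε) :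
    Set.EqOn φ₁ φ₂ {z : ℂ | R < z.re} := by
  have hstep : ∀ z : ℂ, R < z.re → z.re + 1 / 2 ≤ (f z).re := by
    intro z hz
    have h1 := hbound z hz
    have hzn : R ≤ ‖z‖ := hz.le.trans (Complex.re_le_norm z)
    have h2 : C / ‖z‖ ^ 2 ≤ 1 / 2 := by
      rw [div_le_iff₀ (by nlinarith)]
      nlinarith
    have h3 := (abs_le.1 (Complex.abs_re_le_norm (f z - z - 1))).1
    simp only [Complex.sub_re, Complex.one_re] at h3
    linarith
  intro z hz
  have hz' : R < z.re := hz
  have hit : ∀ n : ℕ, ∃ w : ℂ, z.re + n / 2 ≤ w.re ∧ φ₁ w - φ₂ w = φ₁ z - φ₂ z := by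
    intro n
    induction n with
    | zero => exact ⟨z, by simp, rfl⟩
    | succ n ih =>
      obtain ⟨w, hw, he⟩ := ih
      have hn : (0 : ℝ) ≤ n := n.cast_nonneg
      have hwR : R < w.re := by linarith
      refine ⟨f w, ?_, ?_⟩
      · have := hstep w hwR
        push_cast
        linarith
      · rw [habel₁ w hwR, habel₂ w hwR, ← he]
        ring
  have key : ‖φ₁ z - φ₂ z‖ ≤ 0 := by
    refine le_of_forall_pos_le_add ?_
    intro ε hε
    obtain ⟨M₁, hM₁, h₁⟩ := hnorm₁ (ε / 2) (by linarith)
    obtain ⟨M₂, hM₂, h₂⟩ := hnorm₂ (ε / 2) (by linarith)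
    obtain ⟨n, hn⟩ := exists_nat_gt (2 * (max M₁ M₂ - z.re))
    obtain ⟨w, hw, he⟩ := hit n
    have a1 := le_max_left M₁ M₂
    have a2 := le_max_right M₁ M₂
    have b1 := h₁ w (by linarith) (by linarith)
    have b2 := h₂ w (by linarith) (by linarith)
    rw [← he]
    calc ‖φ₁ w - φ₂ w‖ = ‖(φ₁ w - w) - (φ₂ w - w)‖ := by congr 1; ring
      _ ≤ ‖φ₁ w - w‖ + ‖φ₂ w - w‖ := norm_sub_le _ _
      _ ≤ 0 + ε := by linarith
  exact sub_eq_zero.1 (norm_le_zero_iff.1 key)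
end
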